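/- Let n ≥ 3 be an odd integer, k ≥ 2 an integer, and let X_{n,m} = {x ∈ ℝ^n : ‖x‖ ≤ r_0} − ⋃_{i=1}^m {x ∈ ℝ^n : ‖x − x_i‖ < r_i} be a sphere world, where r_0 > 0, ‖x_i‖ + r_i < r_0 for i = 1,…,m, and ‖x_i − x_j‖ > r_i + r_j for all i ≠ j. Then the topological complexity of the configuration space F(X_{n,m},k) equals 2k−1 if m = 0, and equals 2k+1 if m ≥ 1. -/

import Mathlib

open scoped Topology

/-- Ordered configuration space of `k` points in `X`: tuples of pairwise
distinct points, i.e. injective functions `Fin k → X`, topologized as a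
subspace of the product `X^k`. -/
abbrev Conf (X : Type*) [TopologicalSpace X] (k : ℕ) : Type _ :=
  {f : Fin k → X // Function.Injective f}

/-- `X × X` admits a cover by `m` open sets over each of which the endpoints
fibration admits a continuous section (a continuous motion planning rule). -/
def TCCover (X : Type*) [TopologicalSpace X] (m : ℕ) : Prop :=
  ∃ U : Fin m → Set (X × X),
    (∀ i, IsOpen (U i)) ∧ (⋃ i, U i) = Set.univ ∧
    ∀ i, ∃ s : C(↥(U i), C(unitInterval, X)),
      ∀ p : ↥(U i), (s p) 0 = (p : X × X).1 ∧ (s p) 1 = (p : X × X).2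

/-- Farber's topological complexity of a space, valued in `ℕ∞` (it is `⊤ = ∞`
if no finite motion-planning cover exists). -/
noncomputable def TopologicalComplexity (X : Type*) [TopologicalSpace X] : ℕ∞ :=
  sInf {m : ℕ∞ | ∃ c : ℕ, (c : ℕ∞) = m ∧ TCCover X c}

namespace SphereWorld

open Finset

section Cochains

variable {T S : Type*}

/-- Omit the `i`-th term of a sequence. -/
def del (i : ℕ) (s : ℕ → T) : ℕ → T := fun j => if j < i then s j else s (j + 1)

/-- Drop the first `p` terms of a sequence. -/
def shift (p : ℕ) (s : ℕ → T) : ℕ → T := fun j => s (j + p)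

/-- The Alexander–Spanier coboundary of a `p`-cochain, cochains being functions on sequences. -/
def coboundary (p : ℕ) (c : (ℕ → T) → ℤ) (s : ℕ → T) : ℤ :=
  ∑ i ∈ range (p + 2), (-1) ^ i * c (del i s)

/-- A `p`-cochain depends on the first `p + 1` terms only. -/
def IsLocal (p : ℕ) (c : (ℕ → T) → ℤ) : Prop :=
  ∀ s s' : ℕ → T, (∀ j ≤ p, s j = s' j) → c s = c s'

lemma shift_zero (s : ℕ → T) : shift 0 s = s := rfl

lemma IsLocal.coboundary {p : ℕ} {c : (ℕ → T) → ℤ} (hc : IsLocal p c) :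
    IsLocal (p + 1) (coboundary p c) := by
  intro s s' h
  refine sum_congr rfl fun i _ => ?_
  congr 1
  refine hc _ _ fun j hj => ?_
  simp only [del]
  split_ifs <;> exact h _ (by omega)

lemma coboundary_sub (p : ℕ) (a b : (ℕ → T) → ℤ) (s : ℕ → T) :
    coboundary p (fun s => a s - b s) s = coboundary p a s - coboundary p b s := by
  simp only [coboundary, mul_sub, sum_sub_distrib]

lemma coboundary_add (p : ℕ) (a b : (ℕ → T) → ℤ) (s : ℕ → T) :
    coboundary p (fun s => a s + b s) s = coboundary p a s + coboundary p b s := by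
  simp only [coboundary, mul_add, sum_add_distrib]

lemma coboundary_sum {ι : Type*} (t : Finset ι) (p : ℕ) (a : ι → (ℕ → T) → ℤ) (s : ℕ → T) :
    coboundary p (fun s => ∑ x ∈ t, a x s) s = ∑ x ∈ t, coboundary p (a x) s := by
  simp only [coboundary, mul_sum]
  exact sum_comm

lemma del_del {i j : ℕ} (h : i ≤ j) (s : ℕ → T) :
    del j (del i s) = del i (del (j + 1) s) := by
  funext t
  simp only [del]
  split_ifs <;> first | rfl | omega

lemma coboundary_coboundary (p : ℕ) (c : (ℕ → T) → ℤ) (s : ℕ → T) :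
    coboundary (p + 1) (coboundary p c) s = 0 := by
  have key : ∀ F : ℕ → ℕ → ℤ, (∀ i j, i ≤ j → F i j = - F (j + 1) i) →
      ∑ i ∈ range (p + 3), ∑ j ∈ range (p + 2), F i j = 0 := by
    intro F hF
    have h1 : ∑ x ∈ range (p + 3) ×ˢ range (p + 2) with x.1 ≤ x.2, F x.1 x.2
        = - ∑ x ∈ range (p + 3) ×ˢ range (p + 2) with ¬ x.1 ≤ x.2, F x.1 x.2 := by
      rw [← sum_neg_distrib]
      refine sum_bij' (fun x _ => (x.2 + 1, x.1)) (fun x _ => (x.2, x.1 - 1)) ?_ ?_ ?_ ?_ ?_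
      · simp only [mem_filter, mem_product, mem_range]; omega
      · simp only [mem_filter, mem_product, mem_range]; omega
      · simp
      · simp only [mem_filter, mem_product, mem_range]
        rintro ⟨a, b⟩ h
        ext <;> simp at h ⊢
        omega
      · simp only [mem_filter, mem_product, mem_range]
        exact fun x hx => hF _ _ hx.2
    rw [← sum_product', ← sum_filter_add_sum_filter_not _ (fun x : ℕ × ℕ => x.1 ≤ x.2), h1]
    ring
  simp only [coboundary, mul_sum]
  refine key (fun i j => (-1) ^ i * ((-1) ^ j * c (del j (del i s)))) fun i j hij => ?_
  rw [del_del hij]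
  ring

/-- The Leibniz rule for the Alexander–Whitney product. -/
lemma coboundary_cup {p : ℕ} (q : ℕ) {a : (ℕ → T) → ℤ} (b : (ℕ → T) → ℤ) (ha : IsLocal p a)
    (s : ℕ → T) :
    coboundary (p + q) (fun s => a s * b (shift p s)) s =
      coboundary p a s * b (shift (p + 1) s) +
        (-1) ^ p * a s * coboundary q b (shift p s) := by
  have e1 : coboundary p a s * b (shift (p + 1) s) =
      ∑ i ∈ range (p + 1), (-1) ^ i * (a (del i s) * b (shift p (del i s)))
        + (-1) ^ (p + 1) * (a s * b (shift (p + 1) s)) := by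
    rw [coboundary, sum_range_succ, add_mul, sum_mul]
    congr 1
    · refine sum_congr rfl fun i hi => ?_
      rw [mem_range] at hi
      have : shift p (del i s) = shift (p + 1) s := by
        funext t
        simp only [shift, del]
        rw [if_neg (by omega)]
        rfl
      rw [this]; ring
    · rw [ha (del (p + 1) s) s fun j hj => by simp only [del]; rw [if_pos (by omega)]]
      ring
  have e2 : (-1) ^ p * a s * coboundary q b (shift p s) =
      ∑ i ∈ range (q + 1), (-1) ^ (p + 1 + i) * (a (del (p + 1 + i) s) *
        b (shift p (del (p + 1 + i) s))) + (-1) ^ p * (a s * b (shift (p + 1) s)) := by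
    rw [coboundary, sum_range_succ', mul_add, mul_sum]
    congr 1
    · refine sum_congr rfl fun i hi => ?_
      have : shift p (del (p + 1 + i) s) = del (i + 1) (shift p s) := by
        funext t
        simp only [shift, del]
        by_cases h : t < i + 1
        · rw [if_pos h, if_pos (by omega)]
        · rw [if_neg h, if_neg (by omega)]
          congr 1; omega
      rw [this, ha (del (p + 1 + i) s) s fun j hj => by simp only [del]; rw [if_pos (by omega)]]
      ring
    · have : del 0 (shift p s) = shift (p + 1) s := by
        funext t
        simp only [shift, del]
        rw [if_neg (by omega)]
        congr 1; omega
      rw [this]; ring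
  rw [e1, e2, coboundary, show p + q + 2 = (p + 1) + (q + 1) by ring, sum_range_add]
  ring

/-- Iterated product of `d`-cochains. -/
def cupProd (d : ℕ) (a : ℕ → (ℕ → T) → ℤ) (M : ℕ) (s : ℕ → T) : ℤ :=
  ∏ i ∈ range M, a i (shift (i * d) s)

lemma IsLocal.cupProd {d : ℕ} {a : ℕ → (ℕ → T) → ℤ} {M : ℕ} (ha : ∀ i < M, IsLocal d (a i)) :
    IsLocal (M * d) (cupProd d a M) := by
  intro s s' h
  refine prod_congr rfl fun i hi => ha i (mem_range.1 hi) _ _ fun j hj => h _ ?_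
  have : (i + 1) * d ≤ M * d := Nat.mul_le_mul_right _ (mem_range.1 hi)
  rw [add_mul] at this
  omega

lemma cupProd_succ (d : ℕ) (a : ℕ → (ℕ → T) → ℤ) (M : ℕ) (s : ℕ → T) :
    cupProd d a (M + 1) s = cupProd d a M s * a M (shift (M * d) s) :=
  prod_range_succ _ _

/-- Changing even-degree cocycles by coboundaries changes their product by a coboundary. -/
lemma exists_cupProd_sub_eq_coboundary {e : ℕ} (he : Even (e + 1)) {P : Set (ℕ → T)}
    (hPs : ∀ i, ∀ s ∈ P, shift i s ∈ P)
    {a b η : ℕ → (ℕ → T) → ℤ} (M : ℕ)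
    (hal : ∀ i ≤ M, IsLocal (e + 1) (a i))
    (ha : ∀ i ≤ M, ∀ s ∈ P, coboundary (e + 1) (a i) s = 0)
    (hη : ∀ i ≤ M, IsLocal e (η i))
    (hb : ∀ i ≤ M, b i = fun s => a i s - coboundary e (η i) s) :
    ∃ ω : (ℕ → T) → ℤ, IsLocal (M * (e + 1) + e) ω ∧
      (∀ s ∈ P, cupProd (e + 1) a (M + 1) s - cupProd (e + 1) b (M + 1) s
        = coboundary (M * (e + 1) + e) ω s) ∧
      ∀ s ∈ P, coboundary ((M + 1) * (e + 1)) (cupProd (e + 1) b (M + 1)) s = 0 := by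
  have hbl : ∀ i ≤ M, IsLocal (e + 1) (b i) := by
    intro i hi s s' h
    rw [hb i hi]
    simp only
    rw [hal i hi s s' h, (hη i hi).coboundary s s' h]
  have hbc : ∀ i ≤ M, ∀ s ∈ P, coboundary (e + 1) (b i) s = 0 := by
    intro i hi s hs
    rw [hb i hi, coboundary_sub, ha i hi s hs, coboundary_coboundary, sub_zero]
  have hsgn : ∀ N : ℕ, ((-1 : ℤ)) ^ (N * (e + 1)) = 1 := fun N => (he.mul_left N).neg_one_pow
  induction M with
  | zero =>
    refine ⟨η 0, by simpa using hη 0 le_rfl, fun s _ => ?_, fun s hs => ?_⟩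
    · have := congrFun (hb 0 le_rfl) (shift 0 s)
      rw [shift_zero] at this
      simp [cupProd, shift_zero, this]
    · have : cupProd (e + 1) b (0 + 1) = b 0 := by
        funext s
        simp [cupProd, shift_zero]
      rw [this]
      simpa using hbc 0 le_rfl s hs
  | succ M ih =>
    obtain ⟨ω, hωl, hω, hc⟩ := ih (fun i hi => hal i (by omega)) (fun i hi => ha i (by omega))
      (fun i hi => hη i (by omega)) (fun i hi => hb i (by omega)) (fun i hi => hbl i (by omega))
      (fun i hi => hbc i (by omega))
    have hloc : IsLocal ((M + 1) * (e + 1)) (cupProd (e + 1) b (M + 1)) :=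
      IsLocal.cupProd fun i hi => hbl i (by omega)
    refine ⟨fun s => ω s * a (M + 1) (shift (M * (e + 1) + e) s) +
      cupProd (e + 1) b (M + 1) s * η (M + 1) (shift ((M + 1) * (e + 1)) s), ?_, ?_, ?_⟩
    · intro s s' h
      have hh : (M + 1) * (e + 1) = M * (e + 1) + e + 1 := by ring
      refine congrArg₂ (· + ·) (congrArg₂ (· * ·) ?_ ?_) (congrArg₂ (· * ·) ?_ ?_)
      · exact hωl s s' fun j hj => h j (by omega)
      · exact hal _ le_rfl _ _ fun j hj => h _ (by omega)
      · exact hloc s s' fun j hj => h j (by omega)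
      · exact hη _ le_rfl _ _ fun j hj => h _ (by omega)
    · intro s hs
      have h1 := coboundary_cup (e + 1) (a (M + 1)) hωl s
      have h2 := coboundary_cup e (η (M + 1)) hloc s
      rw [ha _ le_rfl _ (hPs _ _ hs)] at h1
      rw [hc s hs, hsgn] at h2
      have hh : (M + 1) * (e + 1) = M * (e + 1) + e + 1 := by ring
      rw [coboundary_add, cupProd_succ _ a (M + 1), cupProd_succ _ b (M + 1)]
      rw [show (M + 1) * (e + 1) + e = M * (e + 1) + e + (e + 1) by ring] at h2 ⊢
      rw [h1, h2, ← hω s hs, ← hh, hb _ le_rfl]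
      ring
    · intro s hs
      have h1 := coboundary_cup (e + 1) (b (M + 1)) hloc s
      rw [hc s hs, hbc _ le_rfl _ (hPs _ _ hs)] at h1
      have : cupProd (e + 1) b (M + 1 + 1) = fun s => cupProd (e + 1) b (M + 1) s *
          b (M + 1) (shift ((M + 1) * (e + 1)) s) := by
        funext s; exact cupProd_succ _ _ _ _
      rw [this, show (M + 1 + 1) * (e + 1) = (M + 1) * (e + 1) + (e + 1) by ring, h1]
      ring

/-- The sequence `f s₀, …, f sᵢ, g sᵢ, g sᵢ₊₁, …`. -/
def prismSeq (f g : T → S) (i : ℕ) (s : ℕ → T) : ℕ → S :=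
  fun t => if t ≤ i then f (s t) else g (s (t - 1))

/-- The prism operator on `e + 1`-cochains for a pair of maps. -/
def prism (e : ℕ) (f g : T → S) (φ : (ℕ → S) → ℤ) (s : ℕ → T) : ℤ :=
  ∑ i ∈ range (e + 1), (-1) ^ i * φ (prismSeq f g i s)

lemma IsLocal.prism {e : ℕ} {f g : T → S} {φ : (ℕ → S) → ℤ} (hφ : IsLocal (e + 1) φ) :
    IsLocal e (prism e f g φ) := by
  intro s s' h
  refine sum_congr rfl fun i hi => ?_
  rw [mem_range] at hi
  congr 1
  refine hφ _ _ fun j hj => ?_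
  simp only [prismSeq]
  split_ifs
  · rw [h j (by omega)]
  · rw [h (j - 1) (by omega)]

lemma coboundary_prism {e : ℕ} {f g : T → S} {φ : (ℕ → S) → ℤ} (hl : IsLocal (e + 1) φ)
    (s : ℕ → T) (hφ : ∀ i ≤ e + 1, coboundary (e + 1) φ (prismSeq f g i s) = 0) :
    coboundary e (prism e f g φ) s = φ (g ∘ s) - φ (f ∘ s) := by
  set G : ℕ → ℕ → ℤ := fun i j => (-1) ^ (i + j) * φ (del j (prismSeq f g i s)) with hG
  set m : ℕ → ℤ := fun i => φ fun t => if t < i then f (s t) else g (s t) with hm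
  have hG1 : ∀ i, G i i = m i := fun i => by
    simp only [hG, hm, (Even.add_self i).neg_one_pow, one_mul]
    congr 1; funext t
    simp only [del, prismSeq]
    split_ifs <;> first | rfl | omega
  have hG2 : ∀ i, G i (i + 1) = - m (i + 1) := fun i => by
    simp only [hG, hm, show i + (i + 1) = i + i + 1 by ring, pow_succ,
      (Even.add_self i).neg_one_pow, one_mul, neg_mul]
    congr 2; funext t
    simp only [del, prismSeq]
    split_ifs <;> first | rfl | omega
  have hG3 : ∀ i j, j ≤ i → (-1) ^ j * ((-1) ^ i * φ (prismSeq f g i (del j s))) = - G (i + 1) j := by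
    intro i j hij
    have : del j (prismSeq f g (i + 1) s) = prismSeq f g i (del j s) := by
      funext t
      simp only [del, prismSeq]
      split_ifs <;> first | rfl | omega | (congr 2; omega)
    simp only [hG, this]; ring
  have hG4 : ∀ i j, i < j → (-1) ^ j * ((-1) ^ i * φ (prismSeq f g i (del j s))) = - G i (j + 1) := by
    intro i j hij
    have : del (j + 1) (prismSeq f g i s) = prismSeq f g i (del j s) := by
      funext t
      simp only [del, prismSeq]
      split_ifs <;> first | rfl | omega | (congr 2; omega)
    simp only [hG, this]; ring
  have h0 : ∑ i ∈ range (e + 2), ∑ j ∈ range (e + 3), G i j = 0 := by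
    refine sum_eq_zero fun i hi => ?_
    have := hφ i (by rw [mem_range] at hi; omega)
    rw [coboundary] at this
    simp only [hG, pow_add, mul_assoc, ← mul_sum]
    rw [this, mul_zero]
  have hsplit : ∀ i j, G i j = (if j < i then G i j else 0) + (if i + 1 < j then G i j else 0) +
      ((if j = i then G i j else 0) + (if j = i + 1 then G i j else 0)) := by
    intro i j
    rcases lt_trichotomy j i with h | h | h
    · simp [h, h.ne, show ¬ i + 1 < j by omega, show j ≠ i + 1 by omega]
    · subst h; simp
    · rcases lt_trichotomy j (i + 1) with h' | h' | h'
      · omega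
      · subst h'; simp
      · simp [h', h'.ne', h.ne', show ¬ j < i by omega]
  have hmid : ∑ i ∈ range (e + 2), ∑ j ∈ range (e + 3),
      ((if j = i then G i j else 0) + (if j = i + 1 then G i j else 0)) = m 0 - m (e + 2) := by
    rw [← sum_range_sub' m (e + 2)]
    refine sum_congr rfl fun i hi => ?_
    rw [mem_range] at hi
    rw [sum_add_distrib, sum_ite_eq', sum_ite_eq', if_pos (by rw [mem_range]; omega),
      if_pos (by rw [mem_range]; omega), hG1, hG2, sub_eq_add_neg]
  have hm0 : m 0 = φ (g ∘ s) := by simp only [hm, not_lt_zero, if_false]; rfl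
  have hm1 : m (e + 2) = φ (f ∘ s) := hl _ _ fun j hj => by
    simp only [show j < e + 2 by omega, if_true]; rfl
  have hmain : ∑ i ∈ range (e + 2), ∑ j ∈ range (e + 3),
      ((if j < i then G i j else 0) + (if i + 1 < j then G i j else 0)) =
      - coboundary e (prism e f g φ) s := by
    have hP : coboundary e (prism e f g φ) s = ∑ x ∈ range (e + 1) ×ˢ range (e + 2),
        (-1) ^ x.2 * ((-1) ^ x.1 * φ (prismSeq f g x.1 (del x.2 s))) := by
      simp only [coboundary, prism, mul_sum]
      rw [sum_comm, sum_product]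
    rw [hP, ← sum_filter_add_sum_filter_not _ (fun x : ℕ × ℕ => x.2 ≤ x.1), neg_add]
    simp only [sum_add_distrib]
    congr 1
    · rw [← sum_product', ← sum_filter, ← sum_neg_distrib]
      refine sum_bij' (fun x _ => (x.1 - 1, x.2)) (fun x _ => (x.1 + 1, x.2)) ?_ ?_ ?_ ?_ ?_
      · simp only [mem_filter, mem_product, mem_range]; omega
      · simp only [mem_filter, mem_product, mem_range]; omega
      · simp only [mem_filter, mem_product, mem_range]
        rintro ⟨a, b⟩ h
        ext <;> simp at h ⊢
        omega
      · simp
      · simp only [mem_filter, mem_product, mem_range]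
        rintro ⟨a, b⟩ h
        obtain ⟨a, rfl⟩ : ∃ a', a = a' + 1 := ⟨a - 1, by simp at h; omega⟩
        simp only [Nat.add_sub_cancel] at h ⊢
        rw [hG3 a b (by omega), neg_neg]
    · rw [← sum_product', ← sum_filter, ← sum_neg_distrib]
      refine sum_bij' (fun x _ => (x.1, x.2 - 1)) (fun x _ => (x.1, x.2 + 1)) ?_ ?_ ?_ ?_ ?_
      · simp only [mem_filter, mem_product, mem_range]; omega
      · simp only [mem_filter, mem_product, mem_range]; omega
      · simp only [mem_filter, mem_product, mem_range]
        rintro ⟨a, b⟩ h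
        ext <;> simp at h ⊢
        omega
      · simp
      · simp only [mem_filter, mem_product, mem_range]
        rintro ⟨a, b⟩ h
        obtain ⟨b, rfl⟩ : ∃ b', b = b' + 1 := ⟨b - 1, by simp at h; omega⟩
        simp only [Nat.add_sub_cancel] at h ⊢
        rw [hG4 a b (by omega), neg_neg]
  rw [sum_congr rfl fun i _ => sum_congr rfl fun j _ => hsplit i j] at h0
  simp only [sum_add_distrib] at h0 hmid hmain
  rw [hmain, hmid, hm0, hm1] at h0
  linarith

end Cochains
section Label

/-- The index of the first positive coordinate, or the last label if there is none. -/
noncomputable def label {d : ℕ} (y : Fin (d + 1) → ℝ) : Fin (d + 2) :=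
  open Classical in
  if h : ∃ b, 0 < y b then (wellFounded_lt.min {b | 0 < y b} h).castSucc else Fin.last _

lemma label_eq_castSucc {d : ℕ} {y : Fin (d + 1) → ℝ} {b : Fin (d + 1)} :
    label y = b.castSucc ↔ 0 < y b ∧ ∀ b' < b, y b' ≤ 0 := by
  unfold label
  split_ifs with h
  · rw [Fin.castSucc_inj]
    constructor
    · rintro rfl
      exact ⟨wellFounded_lt.min_mem {b | 0 < y b} h, fun b' hb' => not_lt.1 fun hp =>
        wellFounded_lt.not_lt_min {b | 0 < y b} hp hb'⟩
    · rintro ⟨h1, h2⟩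
      refine le_antisymm (not_lt.1 (wellFounded_lt.not_lt_min {b | 0 < y b} h1)) (not_lt.1 fun hlt => ?_)
      exact absurd (wellFounded_lt.min_mem {b | 0 < y b} h) (not_lt.2 (h2 _ hlt))
  · push Not at h
    constructor
    · exact fun h' => absurd h' (Fin.castSucc_lt_last b).ne'
    · exact fun h' => absurd h'.1 (not_lt.2 (h b))

lemma label_eq_last {d : ℕ} {y : Fin (d + 1) → ℝ} :
    label y = Fin.last _ ↔ ∀ b, y b ≤ 0 := by
  unfold label
  split_ifs with h
  · constructor
    · exact fun h' => absurd h' (Fin.castSucc_lt_last _).ne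
    · obtain ⟨b, hb⟩ := h
      exact fun h' => absurd hb (not_lt.2 (h' b))
  · push Not at h
    simp [h]

lemma label_smul {d : ℕ} (y : Fin (d + 1) → ℝ) {c : ℝ} (hc : 0 < c) : label (c • y) = label y := by
  refine Fin.lastCases (motive := fun l => label y = l → label (c • y) = l) ?_ ?_ (label y) rfl
  · intro h
    rw [label_eq_last] at h ⊢
    intro b
    simpa using mul_nonpos_of_nonneg_of_nonpos hc.le (h b)
  · intro b h
    rw [label_eq_castSucc] at h ⊢
    refine ⟨by simpa using mul_pos hc h.1, fun b' hb' => ?_⟩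
    simpa using mul_nonpos_of_nonneg_of_nonpos hc.le (h.2 b' hb')

/-- Points close to each other compared with their norm do not carry all labels. -/
lemma exists_label_ne {d : ℕ} (s : ℕ → Fin (d + 1) → ℝ) (ε : ℝ)
    (h1 : ∀ a b, dist (s a) (s b) < ε) (h2 : ∀ a, ε ≤ ‖s a‖) :
    ∃ l, ∀ a, label (s a) ≠ l := by
  by_contra! h
  obtain ⟨a, ha⟩ := h (Fin.last _)
  rw [label_eq_last] at ha
  refine absurd (h2 a) (not_le.2 ?_)
  rw [pi_norm_lt_iff ((dist_nonneg).trans_lt (h1 a a))]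
  intro b
  obtain ⟨a', ha'⟩ := h b.castSucc
  rw [label_eq_castSucc] at ha'
  have := (dist_le_pi_dist (s a) (s a') b).trans_lt (h1 a a')
  rw [Real.dist_eq, abs_lt] at this
  rw [Real.norm_eq_abs, abs_lt]
  constructor <;> linarith [ha b, ha'.1]

/-- The generating `d`-cocycle of the sphere, supported near the last coordinate axis. -/
noncomputable def topCochain (d : ℕ) (s : ℕ → Fin (d + 1) → ℝ) : ℤ :=
  Matrix.det (Matrix.of fun a b : Fin (d + 1) => if label (s a) = b.castSucc then (1 : ℤ) else 0)

lemma topCochain_congr {d : ℕ} {s s' : ℕ → Fin (d + 1) → ℝ}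
    (h : ∀ a ≤ d, label (s a) = label (s' a)) : topCochain d s = topCochain d s' := by
  unfold topCochain
  congr 2
  funext a b
  rw [h a (Nat.lt_succ_iff.1 a.2)]

lemma isLocal_topCochain (d : ℕ) : IsLocal d (topCochain d) :=
  fun _ _ h => topCochain_congr fun a ha => by rw [h a ha]

lemma label_injective_of_topCochain_ne_zero {d : ℕ} {s : ℕ → Fin (d + 1) → ℝ}
    (h : topCochain d s ≠ 0) : Function.Injective fun a : Fin (d + 1) => label (s a) := by
  intro a a' haa
  by_contra hne
  refine h (Matrix.det_zero_of_row_eq hne ?_)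
  funext b
  simp only [Matrix.of_apply]
  simp only at haa
  rw [haa]

lemma label_ne_last_of_topCochain_ne_zero {d : ℕ} {s : ℕ → Fin (d + 1) → ℝ}
    (h : topCochain d s ≠ 0) (a : Fin (d + 1)) : label (s a) ≠ Fin.last _ := by
  intro ha
  refine h (Matrix.det_eq_zero_of_row_eq_zero a fun b => ?_)
  simp only [Matrix.of_apply, ha]
  exact if_neg (Fin.castSucc_lt_last b).ne'

lemma topCochain_eq_sign {d : ℕ} {s : ℕ → Fin (d + 1) → ℝ}
    (h : ∀ a : Fin (d + 1), label (s a) = (Fin.rev a).castSucc) :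
    topCochain d s = Equiv.Perm.sign (Fin.revPerm : Equiv.Perm (Fin (d + 1))) := by
  have : Matrix.of (fun a b : Fin (d + 1) => if label (s a) = b.castSucc then (1 : ℤ) else 0)
      = (Fin.revPerm : Equiv.Perm (Fin (d + 1))).permMatrix ℤ := by
    ext a b
    simp [h, Equiv.Perm.permMatrix, PEquiv.toMatrix_apply, eq_comm]
  rw [topCochain, this, Matrix.det_permutation]
  simp

lemma coboundary_topCochain {d : ℕ} {s : ℕ → Fin (d + 1) → ℝ} (h : ∃ l, ∀ a, label (s a) ≠ l) :
    coboundary d (topCochain d) s = 0 := by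
  set A : Matrix (Fin (d + 2)) (Fin (d + 2)) ℤ := Matrix.of fun i j =>
    Fin.cases (motive := fun _ => ℤ) 1 (fun b => if label (s i) = b.castSucc then 1 else 0) j with hA
  have h0 : A.det = 0 := by
    have hni : ¬ Function.Injective fun i : Fin (d + 2) => label (s i) := by
      rw [Finite.injective_iff_surjective]
      obtain ⟨l, hl⟩ := h
      intro hs
      obtain ⟨i, hi⟩ := hs l
      exact hl _ hi
    simp only [Function.Injective, not_forall] at hni
    obtain ⟨i, j, hij, hne⟩ := hni
    refine Matrix.det_zero_of_row_eq hne ?_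
    funext b
    simp only [hA, Matrix.of_apply]
    rw [hij]
  rw [Matrix.det_succ_column_zero] at h0
  rw [coboundary, Finset.sum_range, ← h0]
  refine sum_congr rfl fun i _ => ?_
  simp only [hA, Matrix.of_apply, Fin.cases_zero, mul_one]
  congr 1
  unfold topCochain
  congr 1
  ext a b
  simp only [Matrix.of_apply, Matrix.submatrix_apply, Fin.cases_succ]
  congr 2
  simp only [del, Fin.succAbove]
  by_cases hh : (a : ℕ) < i
  · rw [if_pos hh, if_pos (by simpa [Fin.lt_def] using hh)]; rfl
  · rw [if_neg hh, if_neg (by simpa [Fin.lt_def] using hh)]; rfl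

end Label

section Grid

variable {ι G : Type*} [Fintype ι] [DecidableEq ι] [AddGroup G] [One G] [Fintype G]

/-- The vertices of the simplex of the cubical grid based at `v` whose coordinate `x` increases
at time `ρ x`. -/
def gridSeq (v : ι → G) (ρ : ι → ℕ) (t : ℕ) : ι → G :=
  fun x => v x + if ρ x < t then 1 else 0

/-- Evaluation of a cochain on the fundamental cycle of the torus `G ^ ι`. -/
def evalCycle {D : ℕ} (o : ι ≃ Fin D) (c : (ℕ → ι → G) → ℤ) : ℤ :=
  ∑ v : ι → G, ∑ π : Equiv.Perm ι, (Equiv.Perm.sign π : ℤ) * c (gridSeq v fun x => o (π x))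

lemma evalCycle_coboundary {p : ℕ} (o : ι ≃ Fin (p + 1)) {c : (ℕ → ι → G) → ℤ} (hc : IsLocal p c) :
    evalCycle o (coboundary p c) = 0 := by
  set F : ℕ → ℤ := fun i => ∑ v : ι → G, ∑ π : Equiv.Perm ι,
    (Equiv.Perm.sign π : ℤ) * c (del i (gridSeq v fun x => o (π x))) with hF
  have hsum : evalCycle o (coboundary p c) = ∑ i ∈ range (p + 2), (-1) ^ i * F i := by
    simp only [evalCycle, coboundary, hF, mul_sum]
    symm
    rw [sum_comm]
    refine sum_congr rfl fun v _ => ?_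
    rw [sum_comm]
    exact sum_congr rfl fun π _ => sum_congr rfl fun i _ => by ring
  have hmid : ∀ i, 0 < i → i < p + 1 → F i = 0 := by
    intro i h0 h1
    suffices F i = - F i by linarith
    simp only [hF, ← sum_neg_distrib]
    refine sum_congr rfl fun v _ => ?_
    set τ : Equiv.Perm ι := Equiv.swap (o.symm ⟨i - 1, by omega⟩) (o.symm ⟨i, h1⟩) with hτ
    have hsgn : (Equiv.Perm.sign τ : ℤ) = -1 := by
      rw [hτ, Equiv.Perm.sign_swap]
      · simp
      · rw [Ne, o.symm.injective.eq_iff, Fin.ext_iff]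
        simp only; omega
    rw [← Equiv.sum_comp (Equiv.mulLeft τ)]
    refine sum_congr rfl fun π _ => ?_
    have : del i (gridSeq v fun x => (o ((τ * π) x) : ℕ)) = del i (gridSeq v fun x => (o (π x) : ℕ)) := by
      funext t x
      have hx : ((o ((τ * π) x) : ℕ) = o (π x)) ∨ ((o (π x) : ℕ) = i - 1 ∧ (o ((τ * π) x) : ℕ) = i) ∨
          ((o (π x) : ℕ) = i ∧ (o ((τ * π) x) : ℕ) = i - 1) := by
        rw [Equiv.Perm.mul_apply, hτ, Equiv.swap_apply_def]
        split_ifs with h2 h3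
        · right; left; simp [h2]
        · right; right; simp [h3]
        · left; rfl
      simp only [del]
      split_ifs with ht <;> simp only [gridSeq] <;> congr 2 <;> apply propext <;> omega
    rw [Equiv.coe_mulLeft, this, Equiv.Perm.sign_mul, Units.val_mul, hsgn]
    ring
  have hends : F 0 = (-1) ^ p * F (p + 1) := by
    set R : Equiv.Perm ι := o.symm.permCongr (finRotate (p + 1)) with hR
    have hsgn : (Equiv.Perm.sign R : ℤ) = (-1) ^ p := by
      rw [hR, Equiv.Perm.sign_permCongr, sign_finRotate]
      simp
    have hswap : ∀ i, F i = ∑ π : Equiv.Perm ι, ∑ v : ι → G,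
        (Equiv.Perm.sign π : ℤ) * c (del i (gridSeq v fun x => o (π x))) := fun i => sum_comm
    rw [hswap, hswap, ← Equiv.sum_comp (Equiv.mulLeft R), mul_sum]
    refine sum_congr rfl fun π _ => ?_
    rw [← Equiv.sum_comp (Equiv.addRight fun x => if (o (π x) : ℕ) = p then (1 : G) else 0)
      fun v => (Equiv.Perm.sign π : ℤ) * c (del (p + 1) (gridSeq v fun x => o (π x))), mul_sum]
    refine sum_congr rfl fun v _ => ?_
    rw [Equiv.coe_mulLeft, Equiv.Perm.sign_mul, Units.val_mul, hsgn, mul_assoc]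
    congr 2
    refine hc _ _ fun t ht => ?_
    funext x
    have hx : ((o ((R * π) x) : ℕ) = o (π x) + 1 ∧ (o (π x) : ℕ) < p) ∨
        ((o ((R * π) x) : ℕ) = 0 ∧ (o (π x) : ℕ) = p) := by
      have hRx : o ((R * π) x) = finRotate (p + 1) (o (π x)) := by simp [hR]
      rw [hRx]
      rcases (Nat.lt_succ_iff.1 (o (π x)).2).lt_or_eq with h | h
      · left
        exact ⟨coe_finRotate_of_ne_last (by rw [Ne, Fin.ext_iff]; simpa using h.ne), h⟩
      · right
        have : o (π x) = Fin.last p := Fin.ext h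
        rw [this, finRotate_last]
        simp
    simp only [del, gridSeq, Equiv.coe_addRight, not_lt_zero, if_false]
    rw [if_pos (by omega : t < p + 1)]
    simp only [gridSeq]
    rcases hx with ⟨h1, h2⟩ | ⟨h1, h2⟩
    · have := h2.ne
      split_ifs <;> first | omega | simp [this]
    · split_ifs <;> first | omega | simp [h2]
  rw [hsum, sum_range_succ, sum_range_succ', sum_eq_zero fun i hi => by
    rw [mem_range] at hi
    rw [hmid _ (by omega) (by omega), mul_zero], hends]
  ring

end Grid
section Circle

variable {N : ℕ} [NeZero N]

lemma toCircle_im (u : ZMod N) :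
    (ZMod.toCircle u : ℂ).im = Real.sin (2 * Real.pi * (u.val / N)) := by
  rw [ZMod.toCircle_apply, ← Complex.exp_ofReal_mul_I_im]
  congr 2
  push_cast
  ring

lemma toCircle_re (u : ZMod N) :
    (ZMod.toCircle u : ℂ).re = Real.cos (2 * Real.pi * (u.val / N)) := by
  rw [ZMod.toCircle_apply, ← Complex.exp_ofReal_mul_I_re]
  congr 2
  push_cast
  ring

lemma val_of_toCircle_im_pos {u : ZMod N} (h : 0 < (ZMod.toCircle u : ℂ).im) :
    0 < u.val ∧ 2 * u.val < N := by
  have hN : (0 : ℝ) < N := Nat.cast_pos.2 (NeZero.pos N)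
  rw [toCircle_im] at h
  constructor
  · rw [Nat.pos_iff_ne_zero]
    rintro h0
    simp [h0] at h
  · by_contra! hle
    have h1 : (1 / 2 : ℝ) ≤ u.val / N := by
      rw [div_le_div_iff₀ two_pos hN]
      exact_mod_cast (by omega : 1 * N ≤ u.val * 2)
    have h2 : (u.val : ℝ) / N ≤ 1 := by
      rw [div_le_one hN]
      exact_mod_cast (ZMod.val_lt u).le
    have h3 := Real.sin_nonneg_of_nonneg_of_le_pi
      (x := 2 * Real.pi * (u.val / N) - Real.pi) (by nlinarith [Real.pi_pos]) (by nlinarith [Real.pi_pos])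
    rw [Real.sin_sub_pi] at h3
    linarith

lemma val_of_toCircle_im_nonpos {u : ZMod N} (h : (ZMod.toCircle u : ℂ).im ≤ 0)
    (h' : 0 < (ZMod.toCircle u : ℂ).re) : u.val = 0 ∨ 3 * N < 4 * u.val := by
  have hN : (0 : ℝ) < N := Nat.cast_pos.2 (NeZero.pos N)
  rw [toCircle_im] at h
  rw [toCircle_re] at h'
  by_contra! hc
  have h0 : (0 : ℝ) < u.val / N := div_pos (Nat.cast_pos.2 (Nat.pos_of_ne_zero hc.1)) hN
  have h1 : (u.val : ℝ) / N ≤ 3 / 4 := by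
    rw [div_le_div_iff₀ hN (by norm_num)]
    exact_mod_cast (by omega : u.val * 4 ≤ 3 * N)
  rcases lt_or_ge ((u.val : ℝ) / N) (1 / 2) with hlt | hge
  · exact absurd h (not_le.2 (Real.sin_pos_of_pos_of_lt_pi (by nlinarith [Real.pi_pos])
      (by nlinarith [Real.pi_pos])))
  · exact absurd h' (not_lt.2 (Real.cos_nonpos_of_pi_div_two_le_of_le (by nlinarith [Real.pi_pos])
      (by nlinarith [Real.pi_pos])))

lemma toCircle_one_im_pos (hN : 4 ≤ N) : 0 < (ZMod.toCircle (1 : ZMod N) : ℂ).im := by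
  have h0 : (0 : ℝ) < N := Nat.cast_pos.2 (NeZero.pos N)
  have h4 : (4 : ℝ) ≤ N := by exact_mod_cast hN
  rw [toCircle_im, show (1 : ZMod N).val = 1 from by
    have : Fact (1 < N) := ⟨by omega⟩
    exact ZMod.val_one N]
  have : (1 : ℝ) / N ≤ 1 / 4 := one_div_le_one_div_of_le (by norm_num) h4
  have h1 : (0 : ℝ) < 1 / N := one_div_pos.2 h0
  push_cast
  exact Real.sin_pos_of_pos_of_lt_pi (by nlinarith [Real.pi_pos]) (by nlinarith [Real.pi_pos])

/-- An edge of the cyclic grid crossing the positive real axis starts at the origin. -/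
lemma eq_zero_of_toCircle_im (hN : 4 ≤ N) {u p q : ZMod N} (hp : p = u ∨ p = u + 1)
    (hq : q = u ∨ q = u + 1) (hpi : (ZMod.toCircle p : ℂ).im ≤ 0)
    (hpr : 0 < (ZMod.toCircle p : ℂ).re) (hqi : 0 < (ZMod.toCircle q : ℂ).im) : u = 0 := by
  have hv1 : (1 : ZMod N).val = 1 := by
    have : Fact (1 < N) := ⟨by omega⟩
    exact ZMod.val_one N
  have h1 := val_of_toCircle_im_pos hqi
  have h2 := val_of_toCircle_im_nonpos hpi hpr
  have hvs : (u + 1).val = if u.val + 1 = N then 0 else u.val + 1 := by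
    rw [ZMod.val_add, hv1]
    have := ZMod.val_lt u
    split_ifs with h
    · rw [h, Nat.mod_self]
    · exact Nat.mod_eq_of_lt (by omega)
  rw [← ZMod.val_eq_zero]
  have := ZMod.val_lt u
  rcases hp with rfl | rfl <;> rcases hq with rfl | rfl <;> split_ifs at hvs <;> omega

end Circle

/-- A degree one map from the torus to the sphere, with values in the punctured space. -/
noncomputable def sphereMap {d : ℕ} (θ : Fin d → Circle) : Fin (d + 1) → ℝ :=
  Fin.snoc (fun r => (θ r : ℂ).im) (∑ r, (θ r : ℂ).re - (d - 1))

lemma sphereMap_castSucc {d : ℕ} (θ : Fin d → Circle) (r : Fin d) :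
    sphereMap θ r.castSucc = (θ r : ℂ).im := by
  simp [sphereMap]

lemma sphereMap_last {d : ℕ} (θ : Fin d → Circle) :
    sphereMap θ (Fin.last d) = ∑ r, (θ r : ℂ).re - (d - 1) := by
  simp [sphereMap]

lemma continuous_sphereMap {d : ℕ} : Continuous (sphereMap (d := d)) := by
  refine continuous_pi fun b => ?_
  refine Fin.lastCases ?_ (fun r => ?_) b
  · have h : (fun θ : Fin d → Circle => sphereMap θ (Fin.last d)) =
        fun θ => ∑ r, (θ r : ℂ).re - (d - 1) := funext sphereMap_last
    rw [h]
    fun_prop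
  · have h : (fun θ : Fin d → Circle => sphereMap θ r.castSucc) = fun θ => (θ r : ℂ).im :=
      funext fun θ => sphereMap_castSucc θ r
    rw [h]
    fun_prop

lemma sum_re_le {d : ℕ} (θ : Fin d → Circle) (r : Fin d) :
    ∑ r, (θ r : ℂ).re ≤ (θ r : ℂ).re + (d - 1) := by
  rw [← Finset.add_sum_erase _ _ (mem_univ r)]
  have : ∑ x ∈ univ.erase r, (θ x : ℂ).re ≤ ∑ x ∈ univ.erase r, (1 : ℝ) := by
    refine sum_le_sum fun x _ => (Complex.re_le_norm _).trans (Circle.norm_coe _).le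
  have hc : ((univ.erase r).card : ℝ) = d - 1 := by
    rw [card_erase_of_mem (mem_univ r), card_univ, Fintype.card_fin, Nat.cast_pred r.pos]
  rw [sum_const, nsmul_eq_mul, mul_one, hc] at this
  linarith

lemma sphereMap_ne_zero {d : ℕ} (θ : Fin d → Circle) : sphereMap θ ≠ 0 := by
  intro h
  have him : ∀ r, (θ r : ℂ).im = 0 := fun r => by
    rw [← sphereMap_castSucc, h]; rfl
  have hre : ∀ r, (θ r : ℂ).re = 1 ∨ (θ r : ℂ).re = -1 := fun r => by
    have := Complex.sq_norm_sub_sq_im (θ r : ℂ)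
    rw [him, Circle.norm_coe] at this
    rw [← sq_eq_one_iff]
    linarith
  have hl : ∑ r, (θ r : ℂ).re - (d - 1) = 0 := by
    rw [← sphereMap_last, h]; rfl
  by_cases hall : ∀ r, (θ r : ℂ).re = 1
  · simp [hall] at hl
  · push Not at hall
    obtain ⟨r, hr⟩ := hall
    have h1 := sum_re_le θ r
    rw [(hre r).resolve_left hr] at h1
    linarith

section Local

variable {N : ℕ} [NeZero N] {d : ℕ}

lemma labels_of_topCochain_ne_zero (hN : 4 ≤ N) {v : Fin d → ZMod N} {ρ : Fin d → ℕ} {t₀ : ℕ}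
    {w : ℕ → Fin (d + 1) → ℝ}
    (hw : ∀ a, w a = sphereMap fun r => ZMod.toCircle (v r + if ρ r < t₀ + a then 1 else 0))
    (h : topCochain d w ≠ 0) :
    v = 0 ∧ (∀ r, ρ r + r + 1 = t₀ + d) ∧
      ∀ a : Fin (d + 1), label (w a) = (Fin.rev a).castSucc := by
  have hinj := label_injective_of_topCochain_ne_zero h
  have hlast := label_ne_last_of_topCochain_ne_zero h
  choose f hf using fun a => Fin.exists_castSucc_eq.2 (hlast a)
  have hfi : Function.Injective f := fun a b hab => hinj (by simp only [← hf, hab])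
  have hfs : Function.Surjective f := Finite.surjective_of_injective hfi
  have hpos : ∀ a : Fin (d + 1), 0 < w a (f a) := fun a => (label_eq_castSucc.1 (hf a).symm).1
  have hnon : ∀ a : Fin (d + 1), ∀ b < f a, w a b ≤ 0 :=
    fun a => (label_eq_castSucc.1 (hf a).symm).2
  have hv : v = 0 := by
    funext r
    obtain ⟨a, ha⟩ := hfs (Fin.last d)
    obtain ⟨a', ha'⟩ := hfs r.castSucc
    have h1 := hpos a
    have h2 := hnon a r.castSucc (by rw [ha]; exact Fin.castSucc_lt_last r)
    have h3 := hpos a'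
    rw [ha, hw, sphereMap_last] at h1
    rw [hw, sphereMap_castSucc] at h2
    rw [ha', hw, sphereMap_castSucc] at h3
    refine eq_zero_of_toCircle_im hN ?_ ?_ h2 ?_ h3
    · split_ifs <;> simp
    · split_ifs <;> simp
    · have := sum_re_le (fun r => ZMod.toCircle (v r + if ρ r < t₀ + a then 1 else 0)) r
      linarith
  have hS : ∀ (a : ℕ) (r : Fin d), 0 < w a r.castSucc ↔ ρ r < t₀ + a := by
    intro a r
    rw [hw, sphereMap_castSucc, hv, Pi.zero_apply, zero_add]
    split_ifs with hlt
    · simp only [hlt, iff_true]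
      exact toCircle_one_im_pos hN
    · simp [hlt]
  have hanti : Antitone f := by
    intro a a' haa
    by_contra! hlt
    have hne : f a ≠ Fin.last d := (hlt.trans_le (Fin.le_last _)).ne
    obtain ⟨r, hr⟩ := Fin.exists_castSucc_eq.2 hne
    have h1 := hpos a
    have h2 := hnon a' (f a) hlt
    rw [← hr] at h1 h2
    rw [hS] at h1
    refine absurd h2 (not_le.2 ((hS _ _).2 ?_))
    have : (a : ℕ) ≤ a' := haa
    omega
  have hrev : ∀ a, f a = Fin.rev a := by
    have hmono : StrictMono (Fin.rev ∘ f) :=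
      Fin.rev_strictAnti.comp (hanti.strictAnti_of_injective hfi)
    have := (StrictMono.range_inj hmono (strictMono_id (α := Fin (d + 1)))).1 (by
      rw [Set.range_id, (Fin.rev_surjective.comp hfs).range_eq])
    intro a
    have h1 := congrFun this a
    simp only [Function.comp_apply, id] at h1
    rw [← h1, Fin.rev_rev, h1]
  refine ⟨hv, fun r => ?_, fun a => by rw [← hf, hrev]⟩
  have hr := r.2
  have h1 := hpos (Fin.rev r.castSucc)
  rw [hrev, Fin.rev_rev, hS] at h1
  have h2 := hnon (Fin.rev r.succ) r.castSucc (by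
    rw [hrev, Fin.rev_rev]; exact Fin.castSucc_lt_succ)
  rw [← not_lt, hS] at h2
  simp only [Fin.val_rev, Fin.val_castSucc, Fin.val_succ] at h1 h2
  omega

lemma labels_eq_rev (hN : 4 ≤ N) {ρ : Fin d → ℕ} {t₀ : ℕ} {w : ℕ → Fin (d + 1) → ℝ}
    (hw : ∀ a, w a = sphereMap fun r => ZMod.toCircle ((0 : ZMod N) + if ρ r < t₀ + a then 1 else 0))
    (hρ : ∀ r, ρ r + r + 1 = t₀ + d) (a : Fin (d + 1)) :
    label (w a) = (Fin.rev a).castSucc := by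
  have hS : ∀ r : Fin d, 0 < w a r.castSucc ↔ ρ r < t₀ + a := by
    intro r
    rw [hw, sphereMap_castSucc, zero_add]
    split_ifs with hlt
    · simp only [hlt, iff_true]
      exact toCircle_one_im_pos hN
    · simp [hlt]
  rw [label_eq_castSucc]
  constructor
  · by_cases ha : a = 0
    · have hno : ∀ r, ¬ ρ r < t₀ := fun r => by have := hρ r; have := r.2; omega
      simp [ha, hw, Fin.rev_zero, sphereMap_last, hno]
    · have ha' := a.2
      have ha0 : (a : ℕ) ≠ 0 := fun h => ha (Fin.ext h)
      have : Fin.rev a = Fin.castSucc ⟨d - a, by omega⟩ := by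
        ext; simp only [Fin.val_rev, Fin.val_castSucc]; omega
      rw [this, hS]
      have := hρ ⟨d - a, by omega⟩
      simp only at this
      omega
  · intro b hb
    have hne : b ≠ Fin.last d := (hb.trans_le (Fin.le_last _)).ne
    obtain ⟨r, rfl⟩ := Fin.exists_castSucc_eq.2 hne
    rw [← not_lt, hS]
    have h1 := hρ r
    rw [Fin.lt_def, Fin.val_rev, Fin.val_castSucc] at hb
    omega

end Local

section Global

variable {N d M : ℕ}

/-- The position of a block of a grid chain on which the top cochain does not vanish. -/
def IsFlag (v : Fin M × Fin d → ZMod N) (ρ : Fin M × Fin d → ℕ) (t₀ : ℕ) (b : Fin M) : Prop :=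
  (∀ r, v (b, r) = 0) ∧ ∀ r : Fin d, ρ (b, r) + r + 1 = t₀ + d

lemma IsFlag.unique (hd : 0 < d) {v : Fin M × Fin d → ZMod N} {ρ : Fin M × Fin d → ℕ}
    (hρ : Function.Injective ρ) {t₀ t₁ : ℕ} {b b' : Fin M} (h : IsFlag v ρ t₀ b)
    (h' : IsFlag v ρ t₁ b') (ht : t₀ = t₁) : b = b' := by
  have h1 := h.2 ⟨0, hd⟩
  have h2 := h'.2 ⟨0, hd⟩
  exact congrArg Prod.fst (hρ (by omega : ρ (b, ⟨0, hd⟩) = ρ (b', ⟨0, hd⟩)))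

lemma sign_eq_one_of_isFlag (hd : Even d) (hM : Even M) (hd0 : 0 < d)
    {v : Fin M × Fin d → ZMod N} {π : Equiv.Perm (Fin M × Fin d)} {σ : Fin M → Fin M}
    (h : ∀ i : Fin M, IsFlag v (fun x => (finProdFinEquiv (π x) : ℕ)) (i * d) (σ i)) :
    Function.Bijective σ ∧ Equiv.Perm.sign π = 1 := by
  have hval : ∀ i r, π (σ i, r) = (i, Fin.rev r) := by
    intro i r
    apply finProdFinEquiv.injective
    ext
    have := (h i).2 r
    rw [finProdFinEquiv_apply_val (i, Fin.rev r)]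
    simp only [Fin.val_rev]
    have := r.2
    rw [mul_comm d]
    simp only at *
    omega
  have hσ : Function.Bijective σ := by
    refine Finite.injective_iff_bijective.1 fun i j hij => ?_
    have h1 := hval i ⟨0, hd0⟩
    rw [hij, hval] at h1
    exact (congrArg Prod.fst h1).symm
  refine ⟨hσ, ?_⟩
  have hmul : π * Equiv.prodCongrLeft (fun _ : Fin d => Equiv.ofBijective σ hσ) =
      Equiv.prodCongrRight fun _ : Fin M => Fin.revPerm := by
    ext1 ⟨i, r⟩
    simp [hval]
  have hs := congrArg Equiv.Perm.sign hmul
  rw [map_mul, Equiv.Perm.sign_prodCongrLeft, Equiv.Perm.sign_prodCongrRight, prod_const,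
    prod_const, card_univ, card_univ, Fintype.card_fin, Fintype.card_fin] at hs
  have hpow : ∀ (u : ℤˣ) {q : ℕ}, Even q → u ^ q = 1 := by
    rintro u _ ⟨q, rfl⟩
    rw [← two_mul, pow_mul, Int.units_sq, one_pow]
  rwa [hpow _ hd, hpow _ hM, mul_one] at hs

variable [NeZero N]

/-- The `b`-th sphere coordinate of a point of a torus. -/
noncomputable def blockMap (b : Fin M) (θ : Fin M × Fin d → Circle) : Fin (d + 1) → ℝ :=
  sphereMap fun r => θ (b, r)

/-- The pullback of the difference of two sphere cochains to the torus. -/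
noncomputable def diffCochain (b b' : Fin M) (s : ℕ → Fin M × Fin d → Circle) : ℤ :=
  topCochain d (blockMap b ∘ s) - topCochain d (blockMap b' ∘ s)

/-- The vertices of a grid cube in the torus. -/
noncomputable def torusSeq (v : Fin M × Fin d → ZMod N) (ρ : Fin M × Fin d → ℕ) (t : ℕ) :
    Fin M × Fin d → Circle :=
  fun x => ZMod.toCircle (gridSeq v ρ t x)

lemma blockMap_shift_torusSeq (v : Fin M × Fin d → ZMod N) (ρ : Fin M × Fin d → ℕ) (b : Fin M)
    (t₀ a : ℕ) : (blockMap b ∘ shift t₀ (torusSeq v ρ)) a =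
      sphereMap fun r => ZMod.toCircle (v (b, r) + if ρ (b, r) < t₀ + a then 1 else 0) := by
  simp only [Function.comp_apply, blockMap, shift, torusSeq, gridSeq, add_comm t₀ a]

lemma isFlag_of_topCochain_ne_zero (hN : 4 ≤ N) {v : Fin M × Fin d → ZMod N}
    {ρ : Fin M × Fin d → ℕ} {t₀ : ℕ} {b : Fin M}
    (h : topCochain d (blockMap b ∘ shift t₀ (torusSeq v ρ)) ≠ 0) : IsFlag v ρ t₀ b := by
  have := labels_of_topCochain_ne_zero (v := fun r => v (b, r)) (ρ := fun r => ρ (b, r)) hN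
    (blockMap_shift_torusSeq v ρ b t₀) h
  exact ⟨congrFun this.1, this.2.1⟩

lemma IsFlag.topCochain_eq (hN : 4 ≤ N) {v : Fin M × Fin d → ZMod N}
    {ρ : Fin M × Fin d → ℕ} {t₀ : ℕ} {b : Fin M} (h : IsFlag v ρ t₀ b) :
    topCochain d (blockMap b ∘ shift t₀ (torusSeq v ρ)) =
      Equiv.Perm.sign (Fin.revPerm (n := d + 1)) := by
  refine topCochain_eq_sign fun a => labels_eq_rev (N := N) (ρ := fun r => ρ (b, r)) hN (t₀ := t₀)
    (fun a => ?_) h.2 a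
  rw [blockMap_shift_torusSeq]
  simp only [h.1]

lemma IsFlag.diffCochain_eq (hN : 4 ≤ N) (hd : 0 < d) {v : Fin M × Fin d → ZMod N}
    {ρ : Fin M × Fin d → ℕ} (hρ : Function.Injective ρ) {t₀ : ℕ} {b b' : Fin M} {e : Fin M → ℤ}
    (heb : e b = 1) (heb' : e b' = -1) {σ : Fin M} (hσ : σ = b ∨ σ = b') (h : IsFlag v ρ t₀ σ) :
    diffCochain b b' (shift t₀ (torusSeq v ρ)) =
      e σ * Equiv.Perm.sign (Fin.revPerm (n := d + 1)) := by
  have hne : b ≠ b' := by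
    rintro rfl
    omega
  have hz : ∀ β, β ≠ σ → topCochain d (blockMap β ∘ shift t₀ (torusSeq v ρ)) = 0 := fun β hβ =>
    not_not.1 fun hc => hβ ((isFlag_of_topCochain_ne_zero hN hc).unique hd hρ h rfl)
  rcases hσ with rfl | rfl
  · rw [diffCochain, hz b' hne.symm, h.topCochain_eq hN, heb, sub_zero, one_mul]
  · rw [diffCochain, hz b hne, h.topCochain_eq hN, heb', zero_sub, neg_one_mul]

lemma exists_isFlag_of_diffCochain_ne_zero (hN : 4 ≤ N) {v : Fin M × Fin d → ZMod N}
    {ρ : Fin M × Fin d → ℕ} {t₀ : ℕ} {b b' : Fin M}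
    (h : diffCochain b b' (shift t₀ (torusSeq v ρ)) ≠ 0) :
    ∃ σ, (σ = b ∨ σ = b') ∧ IsFlag v ρ t₀ σ := by
  by_cases hb : topCochain d (blockMap b ∘ shift t₀ (torusSeq v ρ)) = 0
  · refine ⟨b', Or.inr rfl, isFlag_of_topCochain_ne_zero hN fun hb' => h ?_⟩
    rw [diffCochain, hb, hb', sub_zero]
  · exact ⟨b, Or.inl rfl, isFlag_of_topCochain_ne_zero hN hb⟩

/-- The product of differences of sphere cochains does not vanish on the fundamental cycle of the
torus. -/
lemma evalCycle_cupProd_ne_zero (hN : 4 ≤ N) (hd : Even d) (hd0 : 0 < d) (hM : Even M)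
    {b b' : ℕ → Fin M} {e : Fin M → ℤ} (heb : ∀ i < M, e (b i) = 1) (heb' : ∀ i < M, e (b' i) = -1)
    (hid : ∀ i : Fin M, i = b i ∨ i = b' i) :
    evalCycle finProdFinEquiv (fun s : ℕ → Fin M × Fin d → ZMod N =>
      cupProd d (fun i => diffCochain (b i) (b' i)) M fun t x => ZMod.toCircle (s t x)) ≠ 0 := by
  set C : ℤ := (∏ i, e i) * (Equiv.Perm.sign (Fin.revPerm (n := d + 1)) : ℤ) ^ M with hC
  have he : ∀ i, e i * e i = 1 := fun i => by
    rcases hid i with h | h <;> rw [h]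
    · rw [heb i i.2]; rfl
    · rw [heb' i i.2]; rfl
  have hCC : C * C = 1 := by
    rw [hC, mul_mul_mul_comm, ← prod_mul_distrib, prod_congr rfl fun i _ => he i, prod_const_one,
      ← mul_pow, ← Units.val_mul, Int.units_mul_self, Units.val_one, one_pow, one_mul]
  have hcup : ∀ (v : Fin M × Fin d → ZMod N) (ρ : Fin M × Fin d → ℕ) (hρ : Function.Injective ρ)
      (σ : Fin M → Fin M), (∀ i : Fin M, (σ i = b i ∨ σ i = b' i) ∧ IsFlag v ρ (i * d) (σ i)) →
      Function.Bijective σ →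
      cupProd d (fun i => diffCochain (b i) (b' i)) M (torusSeq v ρ) = C := by
    intro v ρ hρ σ hσ hbij
    rw [cupProd, ← Fin.prod_univ_eq_prod_range
      (fun i => diffCochain (b i) (b' i) (shift (i * d) (torusSeq v ρ)))]
    rw [prod_congr rfl fun i _ => (hσ i).2.diffCochain_eq hN hd0 hρ (heb i i.2) (heb' i i.2)
      (hσ i).1, prod_mul_distrib, prod_const, card_univ, Fintype.card_fin, hC,
      hbij.prod_comp e]
  set term : (Fin M × Fin d → ZMod N) → Equiv.Perm (Fin M × Fin d) → ℤ := fun v π =>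
    (Equiv.Perm.sign π : ℤ) * cupProd d (fun i => diffCochain (b i) (b' i)) M
      (torusSeq v fun x => (finProdFinEquiv (π x) : ℕ)) with hterm
  have hρ : ∀ π : Equiv.Perm (Fin M × Fin d),
      Function.Injective fun x => (finProdFinEquiv (π x) : ℕ) := fun π =>
    Fin.val_injective.comp (finProdFinEquiv.injective.comp π.injective)
  have hnonneg : ∀ v π, 0 ≤ C * term v π := by
    intro v π
    by_cases h0 : term v π = 0
    · rw [h0, mul_zero]
    have h1 := right_ne_zero_of_mul h0
    rw [cupProd, prod_ne_zero_iff] at h1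
    choose σ hσ using fun i : Fin M =>
      exists_isFlag_of_diffCochain_ne_zero hN (h1 i (mem_range.2 i.2))
    obtain ⟨hbij, hsign⟩ := sign_eq_one_of_isFlag hd hM hd0 fun i => (hσ i).2
    simp only [hterm]
    rw [hsign, hcup v _ (hρ π) σ hσ hbij, Units.val_one, one_mul, hCC]
    exact zero_le_one
  have hone : C * term 0 (Equiv.prodCongrRight fun _ : Fin M => Fin.revPerm) = 1 := by
    have hfl : ∀ i : Fin M, IsFlag (0 : Fin M × Fin d → ZMod N) (fun x => (finProdFinEquiv
        ((Equiv.prodCongrRight fun _ : Fin M => Fin.revPerm) x) : ℕ)) (i * d) i := by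
      refine fun i => ⟨fun _ => rfl, fun r => ?_⟩
      simp only [Equiv.prodCongrRight_apply, finProdFinEquiv_apply_val, Fin.revPerm_apply,
        Fin.val_rev]
      have := r.2
      rw [mul_comm d]
      omega
    obtain ⟨hbij, hsign⟩ := sign_eq_one_of_isFlag hd hM hd0 (σ := fun i => i) hfl
    simp only [hterm]
    rw [hsign, hcup 0 _ (hρ _) (fun i => i) (fun i => ⟨hid i, hfl i⟩) hbij, Units.val_one, one_mul,
      hCC]
  intro hzero
  have hsum : 0 < ∑ v, ∑ π, C * term v π :=
    sum_pos' (fun v _ => sum_nonneg fun π _ => hnonneg v π) ⟨0, mem_univ _,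
      sum_pos' (fun π _ => hnonneg 0 π) ⟨Equiv.prodCongrRight fun _ : Fin M => Fin.revPerm,
        mem_univ _, by rw [hone]; exact zero_lt_one⟩⟩
  simp only [← mul_sum] at hsum
  have : ∑ v, ∑ π, term v π = 0 := hzero
  rw [this, mul_zero] at hsum
  exact lt_irrefl _ hsum

end Global
lemma coboundary_comp {T S : Type*} (p : ℕ) (c : (ℕ → S) → ℤ) (f : T → S) (s : ℕ → T) :
    coboundary p (fun s => c (f ∘ s)) s = coboundary p c (f ∘ s) := by
  refine sum_congr rfl fun q _ => congrArg _ (congrArg c (funext fun j => ?_))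
  simp only [Function.comp_apply, del]
  split_ifs <;> rfl

section Deformation

variable {T : Type*} [MetricSpace T]

lemma exists_coboundary_topCochain_comp_eq_zero [CompactSpace T] {d : ℕ} {f : T → Fin (d + 1) → ℝ}
    (hf : Continuous f) (h0 : ∀ x, f x ≠ 0) :
    ∃ ε > 0, ∀ s : ℕ → T, (∀ a b, dist (s a) (s b) < ε) →
      coboundary d (topCochain d) (f ∘ s) = 0 := by
  obtain ⟨r, hr, hmin⟩ := isCompact_univ.exists_forall_le' (hf.norm.continuousOn (s := Set.univ))
    (a := 0) fun x _ => norm_pos_iff.2 (h0 x)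
  obtain ⟨ε, hε, huc⟩ := Metric.uniformContinuous_iff.1
    (CompactSpace.uniformContinuous_of_continuous hf) r hr
  exact ⟨ε, hε, fun s hs => coboundary_topCochain
    (exists_label_ne _ r (fun a b => huc (hs a b)) fun a => hmin _ (Set.mem_univ _))⟩

/-- Homotopic maps to the punctured space pull the sphere cochain back to cohomologous cochains. -/
lemma exists_coboundary_eq_sub_of_homotopy {e : ℕ} {K : Set T} (hK : IsCompact K)
    {H : ℝ × T → Fin (e + 2) → ℝ} (hH : ContinuousOn H (Set.Icc 0 1 ×ˢ K))
    (h0 : ∀ p ∈ Set.Icc (0 : ℝ) 1 ×ˢ K, H p ≠ 0) :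
    ∃ η : (ℕ → T) → ℤ, IsLocal e η ∧ ∃ ε > 0, ∀ s : ℕ → T, (∀ a, s a ∈ K) →
      (∀ a b, dist (s a) (s b) < ε) →
      coboundary e η s = topCochain (e + 1) (fun a => H (0, s a)) -
        topCochain (e + 1) (fun a => H (1, s a)) := by
  have hcpt : IsCompact (Set.Icc (0 : ℝ) 1 ×ˢ K) := isCompact_Icc.prod hK
  obtain ⟨r, hr, hmin⟩ := hcpt.exists_forall_le' hH.norm (a := 0) fun x hx => norm_pos_iff.2 (h0 x hx)
  obtain ⟨ε, hε, huc⟩ := Metric.uniformContinuousOn_iff.1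
    (hcpt.uniformContinuousOn_of_continuous hH) r hr
  obtain ⟨R, hR⟩ := exists_nat_one_div_lt hε
  have hR0 : (0 : ℝ) < R + 1 := by positivity
  set f : ℕ → T → Fin (e + 2) → ℝ := fun q x => H (q / (R + 1), x) with hf
  refine ⟨fun s => ∑ q ∈ range (R + 1), prism e (f (q + 1)) (f q) (topCochain (e + 1)) s,
    fun s s' h => sum_congr rfl fun q _ => (isLocal_topCochain _).prism s s' h, ε, hε,
    fun s hsK hs => ?_⟩
  have hmem : ∀ q ≤ R + 1, ∀ a, ((q / (R + 1), s a) : ℝ × T) ∈ Set.Icc (0 : ℝ) 1 ×ˢ K := by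
    refine fun q hq a => ⟨⟨by positivity, ?_⟩, hsK a⟩
    rw [div_le_one hR0]
    exact_mod_cast hq
  have hcob : ∀ q ∈ range (R + 1),
      coboundary e (prism e (f (q + 1)) (f q) (topCochain (e + 1))) s =
        topCochain (e + 1) (f q ∘ s) - topCochain (e + 1) (f (q + 1) ∘ s) := by
    intro q hq
    rw [mem_range] at hq
    refine coboundary_prism (isLocal_topCochain _) s fun i _ => coboundary_topCochain ?_
    have hval : ∀ t, ∃ q' a, (q' = q ∨ q' = q + 1) ∧
        prismSeq (f (q + 1)) (f q) i s t = H ((q' : ℕ) / (R + 1), s a) := by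
      intro t
      by_cases ht : t ≤ i
      · exact ⟨q + 1, t, Or.inr rfl, by simp [prismSeq, ht, hf]⟩
      · exact ⟨q, t - 1, Or.inl rfl, by simp [prismSeq, ht, hf]⟩
    refine exists_label_ne _ r (fun t t' => ?_) fun t => ?_
    · obtain ⟨q₁, a₁, hq₁, h₁⟩ := hval t
      obtain ⟨q₂, a₂, hq₂, h₂⟩ := hval t'
      rw [h₁, h₂]
      refine huc _ (hmem _ (by omega) _) _ (hmem _ (by omega) _) ?_
      rw [Prod.dist_eq]
      refine max_lt ?_ (hs _ _)
      rw [Real.dist_eq, ← sub_div, abs_div, abs_of_pos hR0]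
      refine lt_of_le_of_lt (div_le_div_of_nonneg_right ?_ hR0.le) hR
      rcases hq₁ with rfl | rfl <;> rcases hq₂ with rfl | rfl <;> simp
    · obtain ⟨q₁, a₁, hq₁, h₁⟩ := hval t
      rw [h₁]
      exact hmin _ (hmem _ (by omega) _)
  rw [coboundary_sum, sum_congr rfl hcob]
  have h1 : f (R + 1) = fun x => H (1, x) := by
    funext x
    simp only [hf]
    rw [Nat.cast_add_one, div_self hR0.ne']
  have h2 : f 0 = fun x => H (0, x) := by
    funext x
    simp [hf]
  rw [sum_range_sub' fun q => topCochain (e + 1) (f q ∘ s), h1, h2]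
  rfl

/-- Homotopic maps to the punctured space, defined near a compact set, pull the sphere cochain back
to cochains that are cohomologous on that set. -/
lemma exists_coboundary_eq_sub_of_homotopyOn {e : ℕ} {C V : Set T} (hC : IsCompact C) (hCV : C ⊆ V)
    {G : unitInterval × V → Fin (e + 2) → ℝ} (hG : Continuous G) (hG0 : ∀ p, G p ≠ 0) :
    ∃ η : (ℕ → T) → ℤ, IsLocal e η ∧ ∃ ε > 0, ∀ s : ℕ → T, ∀ hs : ∀ a, s a ∈ C,
      (∀ a b, dist (s a) (s b) < ε) →
      coboundary e η s = topCochain (e + 1) (fun a => G (0, ⟨s a, hCV (hs a)⟩)) -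
        topCochain (e + 1) (fun a => G (1, ⟨s a, hCV (hs a)⟩)) := by
  classical
  let H : ℝ × T → Fin (e + 2) → ℝ := fun p =>
    if hx : p.2 ∈ V then G (Set.projIcc 0 1 zero_le_one p.1, ⟨p.2, hx⟩) else 0
  have hHV : ∀ p, ∀ hx : p.2 ∈ V, H p = G (Set.projIcc 0 1 zero_le_one p.1, ⟨p.2, hx⟩) :=
    fun p hx => by simp only [H, dif_pos hx]
  have hHc : ContinuousOn H (Set.Icc 0 1 ×ˢ C) := by
    rw [continuousOn_iff_continuous_domRestrict]
    have : (Set.Icc (0 : ℝ) 1 ×ˢ C).domRestrict H = fun p =>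
        G (Set.projIcc 0 1 zero_le_one p.1.1, ⟨p.1.2, hCV p.2.2⟩) := by
      funext p
      exact hHV p.1 (hCV p.2.2)
    rw [this]
    exact hG.comp ((continuous_projIcc.comp (continuous_fst.comp continuous_subtype_val)).prodMk
      ((continuous_snd.comp continuous_subtype_val).subtype_mk _))
  obtain ⟨η, hηl, ε, hε, h⟩ := exists_coboundary_eq_sub_of_homotopy hC hHc (by
    rintro p ⟨-, hp⟩
    rw [hHV p (hCV hp)]
    exact hG0 _)
  refine ⟨η, hηl, ε, hε, fun s hsC hs => ?_⟩
  rw [h s hsC hs]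
  congr 2
  · funext a
    rw [hHV _ (hCV (hsC a)), Set.projIcc_left]
    rfl
  · funext a
    rw [hHV _ (hCV (hsC a)), Set.projIcc_right]
    rfl

end Deformation

lemma exists_dist_toCircle_lt {ε : ℝ} (hε : 0 < ε) :
    ∃ N : ℕ, ∃ _ : NeZero N, 4 ≤ N ∧ ∀ z : ZMod N,
      dist (ZMod.toCircle (z + 1)) (ZMod.toCircle z) < ε := by
  have h1 : Filter.Tendsto (fun N : ℕ => Complex.exp (2 * Real.pi * Complex.I * ((N : ℂ)⁻¹)))
      Filter.atTop (𝓝 1) := by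
    have h : Filter.Tendsto (fun N : ℕ => ((N : ℂ)⁻¹)) Filter.atTop (𝓝 0) :=
      tendsto_inv_atTop_nhds_zero_nat
    have h2 : Continuous fun z : ℂ => Complex.exp (2 * Real.pi * Complex.I * z) := by fun_prop
    have := (h2.tendsto 0).comp h
    simpa [Function.comp_def] using this
  obtain ⟨N, hN, hN4⟩ := ((Metric.tendsto_nhds.1 h1 ε hε).and (Filter.eventually_ge_atTop 4)).exists
  have hne : NeZero N := ⟨by omega⟩
  have : Fact (1 < N) := ⟨by omega⟩
  refine ⟨N, hne, hN4, fun z => ?_⟩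
  rw [AddChar.map_add_eq_mul, show dist (ZMod.toCircle z * ZMod.toCircle 1) (ZMod.toCircle z) =
    dist ((ZMod.toCircle z * ZMod.toCircle 1 : Circle) : ℂ) (ZMod.toCircle z : ℂ) from rfl,
    Complex.dist_eq, Circle.coe_mul]
  have h3 : ((ZMod.toCircle z : ℂ) * (ZMod.toCircle (1 : ZMod N) : ℂ) - (ZMod.toCircle z : ℂ)) =
      (ZMod.toCircle z : ℂ) * ((ZMod.toCircle (1 : ZMod N) : ℂ) - 1) := by ring
  have h4 : (ZMod.toCircle (1 : ZMod N) : ℂ) = Complex.exp (2 * Real.pi * Complex.I * ((N : ℂ)⁻¹)) := by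
    rw [ZMod.toCircle_apply, ZMod.val_one]
    congr 1
    push_cast
    ring
  rw [h3, norm_mul, Circle.norm_coe, one_mul, h4, ← Complex.dist_eq]
  exact hN

lemma evalCycle_eq_zero_of_eq_coboundary {ι G S : Type*} [Fintype ι] [DecidableEq ι] [AddGroup G]
    [One G] [Fintype G] {D p : ℕ} (o : ι ≃ Fin D) (hD : D = p + 1) {c ω : (ℕ → ι → S) → ℤ}
    (hω : IsLocal p ω) (f : G → S)
    (h : ∀ (v : ι → G) (ρ : ι → ℕ), c (fun t x => f (gridSeq v ρ t x)) =
      coboundary p ω fun t x => f (gridSeq v ρ t x)) :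
    evalCycle o (fun s : ℕ → ι → G => c fun t x => f (s t x)) = 0 := by
  subst hD
  have hl : IsLocal p fun s : ℕ → ι → G => ω ((fun θ x => f (θ x)) ∘ s) :=
    fun s s' h => hω _ _ fun j hj => by simp only [Function.comp_apply, h j hj]
  rw [← evalCycle_coboundary o hl]
  refine sum_congr rfl fun v _ => sum_congr rfl fun π _ => ?_
  rw [coboundary_comp]
  exact congrArg _ (h v _)

/-- A space through which `K` sphere maps factor independently does not have topological complexity
at most `2 * K`. -/
theorem not_tcCover_of_sphereMap {X : Type*} [TopologicalSpace X] {e K : ℕ} (he : Even (e + 1))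
    (hK : 0 < K) {F : (Fin K → Fin (e + 1) → Circle) → X} (hF : Continuous F)
    {g : Fin K → X → Fin (e + 2) → ℝ} (hg : ∀ j, Continuous (g j)) (hg0 : ∀ j x, g j x ≠ 0)
    (hgF : ∀ θ j, ∃ l : ℝ, 0 < l ∧ g j (F θ) = l • sphereMap (θ j)) : ¬ TCCover X (2 * K) := by
  rintro ⟨U, hUo, hUc, hsec⟩
  choose sec hsec using hsec
  let lo : Fin K → Fin (2 * K) := fun j => ⟨2 * j, by omega⟩
  let hi : Fin K → Fin (2 * K) := fun j => ⟨2 * j + 1, by omega⟩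
  let jj : ℕ → Fin K := fun i => ⟨(i / 2) % K, Nat.mod_lt _ hK⟩
  let Φ : (Fin (2 * K) × Fin (e + 1) → Circle) → X × X := fun θ =>
    (F fun j r => θ (lo j, r), F fun j r => θ (hi j, r))
  have hΦ : Continuous Φ := by
    refine Continuous.prodMk (hF.comp ?_) (hF.comp ?_) <;> fun_prop
  let V : Fin (2 * K) → Set (Fin (2 * K) × Fin (e + 1) → Circle) := fun i => Φ ⁻¹' U i
  have hVo : ∀ i, IsOpen (V i) := fun i => (hUo i).preimage hΦ
  have hVc : Set.univ ⊆ ⋃ i, V i := by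
    rw [← Set.preimage_iUnion, hUc, Set.preimage_univ]
  obtain ⟨δ, hδ, hleb⟩ := lebesgue_number_lemma_of_metric isCompact_univ hVo hVc
  let C : Fin (2 * K) → Set (Fin (2 * K) × Fin (e + 1) → Circle) := fun i =>
    {x | ∀ y ∉ V i, δ / 2 ≤ dist x y}
  have hCV : ∀ i, C i ⊆ V i := fun i x hx => by
    by_contra hxV
    have := hx x hxV
    rw [dist_self] at this
    linarith
  have hCcpt : ∀ i, IsCompact (C i) := fun i => by
    refine IsClosed.isCompact ?_
    simp only [C, Set.ofPred_forall]
    exact isClosed_iInter fun y => isClosed_iInter fun _ =>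
      isClosed_le continuous_const (continuous_id.dist continuous_const)
  let b : ℕ → Fin (2 * K) := fun i => lo (jj i)
  let b' : ℕ → Fin (2 * K) := fun i => hi (jj i)
  have hη : ∀ i : Fin (2 * K), ∃ η : (ℕ → Fin (2 * K) × Fin (e + 1) → Circle) → ℤ, IsLocal e η ∧
      ∃ ε > 0, ∀ s : ℕ → Fin (2 * K) × Fin (e + 1) → Circle, (∀ a, s a ∈ C i) →
      (∀ a b, dist (s a) (s b) < ε) → coboundary e η s = diffCochain (b i) (b' i) s := by
    intro i
    obtain ⟨η, hηl, ε, hε, h⟩ := exists_coboundary_eq_sub_of_homotopyOn (hCcpt i) (hCV i)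
      (G := fun p => g (jj i) (sec i ⟨Φ p.2, p.2.2⟩ p.1)) (by
        refine (hg _).comp ?_
        have h1 : Continuous fun p : unitInterval × V i => sec i ⟨Φ p.2, p.2.2⟩ :=
          (sec i).continuous.comp
            ((hΦ.comp (continuous_subtype_val.comp continuous_snd)).subtype_mk _)
        exact h1.eval continuous_fst) (fun p => hg0 _ _)
    refine ⟨η, hηl, ε, hε, fun s hsC hs => ?_⟩
    rw [h s hsC hs, diffCochain]
    congr 1
    · refine topCochain_congr fun a _ => ?_
      obtain ⟨l, hl, hgl⟩ := hgF (fun j r => s a (lo j, r)) (jj i)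
      rw [(hsec i ⟨Φ (s a), hCV i (hsC a)⟩).1, hgl, label_smul _ hl]
      rfl
    · refine topCochain_congr fun a _ => ?_
      obtain ⟨l, hl, hgl⟩ := hgF (fun j r => s a (hi j, r)) (jj i)
      rw [(hsec i ⟨Φ (s a), hCV i (hsC a)⟩).2, hgl, label_smul _ hl]
      rfl
  choose η hηl ε₁ hε₁ hη using hη
  have hblock : ∀ i : Fin (2 * K), Continuous (blockMap (d := e + 1) i) := fun i =>
    continuous_sphereMap.comp (by fun_prop)
  choose ε₂ hε₂ hcoc using fun i : Fin (2 * K) =>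
    exists_coboundary_topCochain_comp_eq_zero (hblock i) fun x => sphereMap_ne_zero _
  obtain ⟨ε, ⟨⟨hεδ, hεε₁⟩, hεε₂⟩, hε⟩ : ∃ ε : ℝ, ((ε ≤ δ / 2 ∧ ∀ i, ε ≤ ε₁ i) ∧ ∀ i, ε ≤ ε₂ i) ∧
      0 < ε := by
    have hle : ∀ {x : ℝ}, 0 < x → ∀ᶠ ε in 𝓝[>] (0 : ℝ), ε ≤ x := fun hx =>
      Filter.mem_of_superset (Ioc_mem_nhdsGT hx) fun _ h => h.2
    exact ((((hle (half_pos hδ)).and (Filter.eventually_all.2 fun i => hle (hε₁ i))).and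
      (Filter.eventually_all.2 fun i => hle (hε₂ i))).and self_mem_nhdsWithin).exists
  obtain ⟨N, hNe, hN4, hN⟩ := exists_dist_toCircle_lt hε
  let P : Set (ℕ → Fin (2 * K) × Fin (e + 1) → Circle) := {s | ∀ a b, dist (s a) (s b) < ε}
  have hgrid : ∀ (v : Fin (2 * K) × Fin (e + 1) → ZMod N) ρ,
      (fun t x => ZMod.toCircle (gridSeq v ρ t x)) ∈ P := by
    intro v ρ a a'
    rw [dist_pi_lt_iff hε]
    intro x
    simp only [gridSeq]
    split_ifs
    · simpa using hε
    · rw [add_zero]; exact hN _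
    · rw [add_zero, dist_comm]; exact hN _
    · simpa using hε
  have hη' : ∀ i : ℕ, ∃ η' : (ℕ → Fin (2 * K) × Fin (e + 1) → Circle) → ℤ, IsLocal e η' ∧
      ∀ hi : i < 2 * K, η' = η ⟨i, hi⟩ := by
    intro i
    by_cases hi : i < 2 * K
    · exact ⟨η ⟨i, hi⟩, hηl _, fun _ => rfl⟩
    · exact ⟨fun _ => 0, fun _ _ _ => rfl, fun h => absurd h hi⟩
  choose η' hη'l hη' using hη'
  obtain ⟨M, hM⟩ : ∃ M, 2 * K = M + 1 := ⟨2 * K - 1, by omega⟩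
  obtain ⟨ω, hωl, hω, -⟩ := exists_cupProd_sub_eq_coboundary he (P := P)
    (fun i s hs a b => hs _ _) (a := fun i => diffCochain (b i) (b' i))
    (b := fun i s => diffCochain (b i) (b' i) s - coboundary e (η' i) s) (η := η') M
    (fun i _ s s' h => by
      simp only [diffCochain]
      congr 1 <;> exact isLocal_topCochain _ _ _ fun j hj => by
        simp only [Function.comp_apply]; rw [h j hj])
    (fun i _ s hs => by
      have h1 : diffCochain (d := e + 1) (b i) (b' i) = fun s => topCochain (e + 1) (blockMap (b i) ∘ s) -
        topCochain (e + 1) (blockMap (b' i) ∘ s) := rfl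
      rw [h1, coboundary_sub]
      rw [coboundary_comp, coboundary_comp, hcoc _ s fun a b => (hs a b).trans_le (hεε₂ _),
        hcoc _ s fun a b => (hs a b).trans_le (hεε₂ _), sub_zero])
    (fun i _ => hη'l i) (fun i _ => rfl)
  have hvanish : ∀ s ∈ P, cupProd (e + 1)
      (fun i s => diffCochain (b i) (b' i) s - coboundary e (η' i) s) (M + 1) s = 0 := by
    intro s hs
    obtain ⟨i, hi⟩ := hleb (s 0) (Set.mem_univ _)
    rw [cupProd]
    refine prod_eq_zero (mem_range.2 (by omega : (i : ℕ) < M + 1)) ?_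
    rw [sub_eq_zero, hη' i i.2, hη i]
    · intro a y hy
      by_contra! hlt
      refine hy (hi ?_)
      rw [Metric.mem_ball]
      have h1 : dist (s (a + i * (e + 1))) (s 0) < ε := hs _ _
      have h2 : dist (s (a + i * (e + 1))) y < δ / 2 := hlt
      rw [dist_comm] at h2
      exact (dist_triangle _ _ _).trans_lt (by linarith)
    · exact fun a b => (hs _ _).trans_le (hεε₁ i)
  have hcup : ∀ s ∈ P, cupProd (e + 1) (fun i => diffCochain (b i) (b' i)) (2 * K) s =
      coboundary (M * (e + 1) + e) ω s := fun s hs => by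
    have h1 := hω s hs
    rwa [hvanish s hs, sub_zero, ← hM] at h1
  refine evalCycle_cupProd_ne_zero (N := N) hN4 he (Nat.succ_pos e) (even_two_mul K)
    (b := b) (b' := b') (e := fun i => (-1) ^ (i : ℕ)) ?_ ?_ ?_ (evalCycle_eq_zero_of_eq_coboundary _ ?_ hωl _
    fun v ρ => hcup _ (hgrid v ρ))
  · intro i _
    exact (even_two_mul _).neg_one_pow
  · intro i _
    exact (even_two_mul (jj i : ℕ)).add_one.neg_one_pow
  · intro i
    have hi2 : (i : ℕ) / 2 % K = i / 2 := Nat.mod_eq_of_lt (by omega)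
    rcases Nat.even_or_odd' (i : ℕ) with ⟨q, hq | hq⟩
    · refine Or.inl (Fin.ext ?_)
      simp only [b, lo, jj, hi2]
      omega
    · refine Or.inr (Fin.ext ?_)
      simp only [b', hi, jj, hi2]
      omega
  · rw [hM]
    ring

section Planner

variable {X Y : Type*} [TopologicalSpace X] [TopologicalSpace Y]

/-- The first endpoint, as a map on a set of pairs. -/
def fstMap (U : Set (X × X)) : C(U, X) := ⟨fun p => p.1.1, by fun_prop⟩

/-- The second endpoint, as a map on a set of pairs. -/
def sndMap (U : Set (X × X)) : C(U, X) := ⟨fun p => p.1.2, by fun_prop⟩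

/-- The endpoint maps are homotopic on a set of pairs, i.e. it has a motion planner. -/
def HasPlan (U : Set (X × X)) : Prop := (fstMap U).Homotopic (sndMap U)

lemma HasPlan.exists_section {U : Set (X × X)} (h : HasPlan U) :
    ∃ s : C(↥U, C(unitInterval, X)),
      ∀ p : ↥U, (s p) 0 = (p : X × X).1 ∧ (s p) 1 = (p : X × X).2 := by
  obtain ⟨H⟩ := h
  exact ⟨(H.toContinuousMap.comp ⟨Prod.swap, continuous_swap⟩).curry,
    fun p => ⟨H.map_zero_left p, H.map_one_left p⟩⟩

lemma tcCover_of_hasPlan {m : ℕ} {U : Fin m → Set (X × X)} (hU : ∀ i, IsOpen (U i))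
    (hc : ⋃ i, U i = Set.univ) (h : ∀ i, HasPlan (U i)) : TCCover X m :=
  ⟨U, hU, hc, fun i => (h i).exists_section⟩

/-- Padding a cover with empty sets. -/
lemma tcCover_mono {m m' : ℕ} (h : TCCover X m) (hm : m ≤ m') : TCCover X m' := by
  obtain ⟨U, hUo, hUc, hs⟩ := h
  choose s hs using hs
  have hV : ∀ i : Fin m', ∃ V : Set (X × X), IsOpen V ∧ (∀ hi : (i : ℕ) < m, V = U ⟨i, hi⟩) ∧
      ∃ s : C(↥V, C(unitInterval, X)),
        ∀ p : ↥V, (s p) 0 = (p : X × X).1 ∧ (s p) 1 = (p : X × X).2 := by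
    intro i
    by_cases hi : (i : ℕ) < m
    · exact ⟨U ⟨i, hi⟩, hUo _, fun _ => rfl, s _, hs _⟩
    · exact ⟨∅, isOpen_empty, fun h => absurd h hi,
        ⟨fun p => p.2.elim, continuous_iff_continuousAt.2 fun p => p.2.elim⟩, fun p => p.2.elim⟩
  choose V hVo hVU hVs using hV
  refine ⟨V, hVo, Set.eq_univ_of_forall fun z => ?_, hVs⟩
  obtain ⟨i, hi⟩ := Set.mem_iUnion.1 (hUc.ge (Set.mem_univ z))
  refine Set.mem_iUnion.2 ⟨Fin.castLE hm i, ?_⟩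
  rw [hVU _ i.2]
  exact hi

/-- Motion planners pull back along a map with a left homotopy inverse. -/
lemma HasPlan.preimage {V : Set (Y × Y)} (h : HasPlan V) (f : C(X, Y)) (g : C(Y, X))
    (hgf : (ContinuousMap.id X).Homotopic (g.comp f)) :
    HasPlan (Prod.map f f ⁻¹' V : Set (X × X)) := by
  set U : Set (X × X) := Prod.map f f ⁻¹' V
  let q : C(U, V) := ⟨fun p => ⟨Prod.map f f p.1, p.2⟩, by fun_prop⟩
  have h1 : (fstMap U).Homotopic ((g.comp f).comp (fstMap U)) := by
    simpa using hgf.comp (ContinuousMap.Homotopic.refl (fstMap U))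
  have h2 : (sndMap U).Homotopic ((g.comp f).comp (sndMap U)) := by
    simpa using hgf.comp (ContinuousMap.Homotopic.refl (sndMap U))
  have h3 : (g.comp ((fstMap V).comp q)).Homotopic (g.comp ((sndMap V).comp q)) :=
    (ContinuousMap.Homotopic.refl g).comp (h.comp (ContinuousMap.Homotopic.refl q))
  exact (h1.trans h3).trans h2.symm

lemma HasPlan.mono {U V : Set (X × X)} (h : HasPlan V) (hUV : U ⊆ V) : HasPlan U :=
  h.comp (ContinuousMap.Homotopic.refl ⟨Set.inclusion hUV, continuous_inclusion hUV⟩)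

lemma HasPlan.iUnion {Θ : Type*} {W : Θ → Set (X × X)} (hW : ∀ θ, IsOpen (W θ))
    (hd : Pairwise fun θ θ' => Disjoint (W θ) (W θ')) (h : ∀ θ, HasPlan (W θ)) :
    HasPlan (⋃ θ, W θ) := by
  let H := fun θ => (h θ).some
  choose idx hidx using fun p : ↥(⋃ θ, W θ) => Set.mem_iUnion.1 p.2
  have huniq : ∀ (p : ↥(⋃ θ, W θ)) θ, p.1 ∈ W θ → idx p = θ := fun p θ hp => by
    by_contra hne
    exact Set.disjoint_left.1 (hd hne) (hidx p) hp
  let G : unitInterval × ↥(⋃ θ, W θ) → X := fun q => H (idx q.2) (q.1, ⟨q.2.1, hidx q.2⟩)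
  have hG : ∀ θ (q : unitInterval × ↥(⋃ θ, W θ)) (hq : q.2.1 ∈ W θ),
      G q = H θ (q.1, ⟨q.2.1, hq⟩) := by
    intro θ q hq
    obtain rfl := huniq q.2 θ hq
    rfl
  have hGc : Continuous G := by
    refine continuous_iff_continuousAt.2 fun q => ?_
    let O : Set (unitInterval × ↥(⋃ θ, W θ)) := {q' | q'.2.1 ∈ W (idx q.2)}
    have hO : IsOpen O := (hW (idx q.2)).preimage (continuous_subtype_val.comp continuous_snd)
    refine ContinuousOn.continuousAt (s := O) ?_ (hO.mem_nhds (hidx q.2))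
    rw [continuousOn_iff_continuous_domRestrict]
    have : O.domRestrict G = fun q' => H (idx q.2) (q'.1.1, ⟨q'.1.2.1, q'.2⟩) := by
      funext q'
      exact hG _ _ q'.2
    rw [this]
    fun_prop
  exact ⟨⟨⟨G, hGc⟩, fun p => (H (idx p)).map_zero_left _, fun p => (H (idx p)).map_one_left _⟩⟩

/-- A stratification of the pairs by levels, such that nearby pairs have the same type or a higher
level, with planners near each type, gives a motion planning cover indexed by the levels. -/
lemma tcCover_of_levels {X : Type*} [MetricSpace X] {Θ : Type*} {c : ℕ} (type : X × X → Θ)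
    (lev : X × X → ℕ) (hlev : ∀ z, lev z < c)
    (hloc : ∀ z, ∀ᶠ z' in 𝓝 z, type z' = type z ∨ lev z < lev z')
    (hplan : ∀ θ, ∃ W : Set (X × X), IsOpen W ∧ (∀ z, type z = θ → z ∈ W) ∧ HasPlan W) :
    TCCover X c := by
  choose W hWo hW hplan using hplan
  have hr : ∀ z, ∃ r > 0, ∀ z', dist z' z < r →
      (type z' = type z ∨ lev z < lev z') ∧ z' ∈ W (type z) := fun z =>
    Metric.eventually_nhds_iff.1 ((hloc z).and ((hWo _).mem_nhds (hW _ z rfl)))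
  choose r hr0 hr using hr
  let O : Fin c → Θ → Set (X × X) := fun l θ =>
    ⋃ z ∈ {z | type z = θ ∧ lev z = l}, Metric.ball z (r z / 2)
  have hO : ∀ l θ, IsOpen (O l θ) := fun l θ => isOpen_biUnion fun z _ => Metric.isOpen_ball
  refine tcCover_of_hasPlan (U := fun l => ⋃ θ, O l θ) (fun l => isOpen_iUnion (hO l)) ?_
    fun l => HasPlan.iUnion (hO l) ?_ fun θ => (hplan θ).mono ?_
  · refine Set.eq_univ_of_forall fun z => Set.mem_iUnion.2 ⟨⟨lev z, hlev z⟩,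
      Set.mem_iUnion.2 ⟨type z, Set.mem_biUnion (x := z) ⟨rfl, rfl⟩ ?_⟩⟩
    exact Metric.mem_ball_self (half_pos (hr0 z))
  · intro θ θ' hne
    refine Set.disjoint_left.2 fun p hp hp' => ?_
    simp only [O, Set.mem_iUnion, Set.mem_ofPred_eq, Metric.mem_ball, exists_prop] at hp hp'
    obtain ⟨z, ⟨hz, hzl⟩, hd⟩ := hp
    obtain ⟨z', ⟨hz', hzl'⟩, hd'⟩ := hp'
    have htri : dist z z' < r z / 2 + r z' / 2 := by
      rw [dist_comm] at hd
      exact (dist_triangle _ _ _).trans_lt (add_lt_add hd hd')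
    rcases le_total (r z) (r z') with hle | hle
    · rcases (hr z' z (by linarith)).1 with h | h
      · exact hne (hz ▸ hz' ▸ h)
      · omega
    · rcases (hr z z' (by rw [dist_comm]; linarith)).1 with h | h
      · exact hne (hz ▸ hz' ▸ h.symm)
      · omega
  · intro p hp
    simp only [O, Set.mem_iUnion, Set.mem_ofPred_eq, Metric.mem_ball, exists_prop] at hp
    obtain ⟨z, ⟨rfl, -⟩, hd⟩ := hp
    exact (hr z p (hd.trans (half_lt_self (hr0 z)))).2

end Planner

/-- Configurations of `k` points in the complement of the distinct points `c i`. -/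
abbrev RelConf {V : Type*} {m : ℕ} (c : Fin m → V) (k : ℕ) : Type _ :=
  {x : Fin k → V // Function.Injective (Sum.elim x c)}

section UpperBound

variable {B : Type*} {m k : ℕ} {c : Fin m → B × ℝ}

/-- The points of a configuration together with the punctures. -/
def allPts (x : RelConf c k) : Fin k ⊕ Fin m → B × ℝ := Sum.elim x.1 c

/-- The vertical order of the points lying over the same point of the base. -/
def vertOrder (x : RelConf c k) (j j' : Fin k ⊕ Fin m) : Prop :=
  (allPts x j).1 = (allPts x j').1 ∧ (allPts x j).2 < (allPts x j').2

/-- The configurations compatible with a vertical order. -/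
def compatSet (c : Fin m → B × ℝ) (L : Fin k ⊕ Fin m → Fin k ⊕ Fin m → Prop) :
    Set (RelConf c k) :=
  {x | ∀ j j', (L j j' → (allPts x j).2 < (allPts x j').2) ∧
    (j ≠ j' → ¬ L j j' → ¬ L j' j → (allPts x j).1 ≠ (allPts x j').1)}

lemma vertOrder_total {x : RelConf c k} {j j' : Fin k ⊕ Fin m} (hne : j ≠ j')
    (h : (allPts x j).1 = (allPts x j').1) : vertOrder x j j' ∨ vertOrder x j' j := by
  rcases lt_trichotomy (allPts x j).2 (allPts x j').2 with hlt | heq | hgt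
  · exact Or.inl ⟨h, hlt⟩
  · exact absurd (x.2 (Prod.ext h heq)) hne
  · exact Or.inr ⟨h.symm, hgt⟩

lemma mem_compatSet_vertOrder (x : RelConf c k) : x ∈ compatSet c (vertOrder x) :=
  fun _ _ => ⟨fun h => h.2, fun hne h1 h2 heq => (vertOrder_total hne heq).elim h1 h2⟩

lemma eventually_affine_ne {p q : ℝ} (hq : q ≠ 0) : ∀ᶠ ε in 𝓝[>] (0 : ℝ), p + ε * q ≠ 0 := by
  by_cases hp : p = 0
  · filter_upwards [self_mem_nhdsWithin] with ε hε
    simpa [hp, hq] using (ne_of_gt hε : ε ≠ 0)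
  · have : ContinuousAt (fun ε : ℝ => p + ε * q) 0 := by fun_prop
    exact (this.eventually_ne (by simpa using hp)).filter_mono nhdsWithin_le_nhds

/-- Generic heights compatible with the vertical order of a configuration. -/
lemma exists_heights (x : RelConf c k) : ∃ h : Fin k → ℝ,
    (∀ j j', vertOrder x j j' → (Sum.elim h fun i => (c i).2 : Fin k ⊕ Fin m → ℝ) j <
      (Sum.elim h fun i => (c i).2 : Fin k ⊕ Fin m → ℝ) j') ∧
    ∀ a j, j ≠ Sum.inl a → h a ≠ (Sum.elim h fun i => (c i).2 : Fin k ⊕ Fin m → ℝ) j := by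
  let w : Fin k ⊕ Fin m → ℝ := Sum.elim (fun a => (a : ℝ) + 1) fun _ => 0
  let h : ℝ → Fin k → ℝ := fun ε a => (x.1 a).2 + ε * ((a : ℝ) + 1)
  have hval : ∀ ε j, (Sum.elim (h ε) fun i => (c i).2 : Fin k ⊕ Fin m → ℝ) j =
      (allPts x j).2 + ε * w j := by
    rintro ε (a | i)
    · rfl
    · simp [allPts, w]
  have h1 : ∀ j j', ∀ᶠ ε in 𝓝[>] (0 : ℝ), vertOrder x j j' →
      (allPts x j).2 + ε * w j < (allPts x j').2 + ε * w j' := by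
    intro j j'
    by_cases hv : vertOrder x j j'
    · have hc : ∀ j, ContinuousAt (fun ε : ℝ => (allPts x j).2 + ε * w j) 0 := fun j => by fun_prop
      filter_upwards [((hc j).eventually_lt (hc j') (by simpa using hv.2)).filter_mono
        nhdsWithin_le_nhds] with ε hε _ using hε
    · exact Filter.Eventually.of_forall fun ε h => absurd h hv
  have h2 : ∀ a j, ∀ᶠ ε in 𝓝[>] (0 : ℝ), j ≠ Sum.inl a →
      (allPts x (Sum.inl a)).2 + ε * w (Sum.inl a) ≠ (allPts x j).2 + ε * w j := by
    intro a j
    by_cases hj : j = Sum.inl a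
    · exact Filter.Eventually.of_forall fun ε h => absurd hj h
    · have hw : w (Sum.inl a) - w j ≠ 0 := by
        rw [sub_ne_zero]
        rcases j with b | i
        · simpa [w, Fin.val_inj] using fun hab : a = b => hj (by rw [hab])
        · simp only [w, Sum.elim_inl, Sum.elim_inr]
          positivity
      filter_upwards [eventually_affine_ne (p := (allPts x (Sum.inl a)).2 - (allPts x j).2) hw]
        with ε hε _ heq
      exact hε (by linear_combination heq)
  obtain ⟨ε, hε1, hε2⟩ := ((Filter.eventually_all.2 fun j => Filter.eventually_all.2 (h1 j)).and
    (Filter.eventually_all.2 fun a => Filter.eventually_all.2 (h2 a))).exists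
  refine ⟨h ε, fun j j' hv => ?_, fun a j hj => ?_⟩
  · rw [hval, hval]
    exact hε1 j j' hv
  · have := hε2 a j hj
    rwa [← hval, ← hval] at this

/-- A configuration from its base points and its heights, when the heights are generic. -/
lemma injective_of_heights (hc : Function.Injective c) {h : Fin k → ℝ}
    (hh : ∀ a j, j ≠ Sum.inl a → h a ≠ (Sum.elim h fun i => (c i).2 : Fin k ⊕ Fin m → ℝ) j)
    (b : Fin k → B) : Function.Injective (Sum.elim (fun a => (b a, h a)) c) := by
  have hsnd : ∀ j, ((Sum.elim (fun a => (b a, h a)) c : Fin k ⊕ Fin m → B × ℝ) j).2 =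
      (Sum.elim h fun i => (c i).2 : Fin k ⊕ Fin m → ℝ) j := by
    rintro (a | i) <;> rfl
  intro j j' heq
  by_contra hne
  have h2 := congrArg Prod.snd heq
  rw [hsnd, hsnd] at h2
  rcases j with a | i
  · exact hh a j' (Ne.symm hne) h2
  · rcases j' with a' | i'
    · exact hh a' _ hne h2.symm
    · exact hne (congrArg _ (hc heq))

open Classical in
/-- The number of base points of a configuration. -/
noncomputable def numBase (x : RelConf c k) : ℕ :=
  (Finset.univ.image fun j => (allPts x j).1).card

lemma numBase_le (x : RelConf c k) : numBase x ≤ k + m := by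
  classical
  refine Finset.card_image_le.trans ?_
  simp

lemma le_numBase (hc : Function.Injective fun i => (c i).1) (hk : 0 < k) (x : RelConf c k) :
    max m 1 ≤ numBase x := by
  classical
  refine max_le ?_ (Finset.card_pos.2 ⟨_, Finset.mem_image_of_mem _
    (Finset.mem_univ (Sum.inl ⟨0, hk⟩))⟩)
  calc m = (Finset.univ.image fun i => (c i).1).card := by
        rw [Finset.card_image_of_injective _ hc, Finset.card_univ, Fintype.card_fin]
    _ ≤ _ := Finset.card_le_card fun b hb => by
        obtain ⟨i, -, rfl⟩ := Finset.mem_image.1 hb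
        exact Finset.mem_image.2 ⟨Sum.inr i, Finset.mem_univ _, rfl⟩

lemma card_image_le_of_factors {ι α β : Type*} [Fintype ι] [DecidableEq α] [DecidableEq β]
    {f : ι → α} {g : ι → β} (h : ∀ i j, f i = f j → g i = g j) :
    (Finset.univ.image g).card ≤ (Finset.univ.image f).card ∧
      ((Finset.univ.image g).card = (Finset.univ.image f).card →
        ∀ i j, g i = g j → f i = f j) := by
  rcases isEmpty_or_nonempty ι with hι | ⟨⟨i₀⟩⟩
  · exact ⟨by simp, fun _ i => hι.elim i⟩
  have : Nonempty β := ⟨g i₀⟩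
  have hfac : g = Function.extend f g (fun _ => g i₀) ∘ f :=
    (Function.FactorsThrough.extend_comp (fun _ => g i₀) fun i j hij => h i j hij).symm
  have himg : (Finset.univ.image g) =
      (Finset.univ.image f).image (Function.extend f g fun _ => g i₀) := by
    rw [Finset.image_image, ← hfac]
  refine ⟨himg ▸ Finset.card_image_le, fun hcard i j hij => ?_⟩
  rw [himg, Finset.card_image_iff] at hcard
  refine hcard (by simp) (by simp) ?_
  rw [hfac] at hij
  exact hij

variable [NormedAddCommGroup B]

lemma continuous_allPts (j : Fin k ⊕ Fin m) : Continuous fun x : RelConf c k => allPts x j := by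
  rcases j with a | i
  · exact (continuous_apply a).comp continuous_subtype_val
  · exact continuous_const

lemma isOpen_compatSet (L : Fin k ⊕ Fin m → Fin k ⊕ Fin m → Prop) :
    IsOpen (compatSet c L) := by
  simp only [compatSet, Set.ofPred_forall, Set.ofPred_and]
  refine isOpen_iInter_of_finite fun j => isOpen_iInter_of_finite fun j' => IsOpen.inter ?_ ?_
  · exact isOpen_iInter_of_finite fun _ => isOpen_lt (continuous_allPts j).snd
      (continuous_allPts j').snd
  · exact isOpen_iInter_of_finite fun _ => isOpen_iInter_of_finite fun _ =>
      isOpen_iInter_of_finite fun _ => isOpen_ne_fun (continuous_allPts j).fst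
        (continuous_allPts j').fst

lemma eventually_vertOrder (x : RelConf c k) : ∀ᶠ x' in 𝓝 x, numBase x ≤ numBase x' ∧
    (vertOrder x' = vertOrder x ∨ numBase x < numBase x') := by
  classical
  have h1 : ∀ᶠ x' in 𝓝 x, ∀ j j', (allPts x j).1 ≠ (allPts x j').1 →
      (allPts x' j).1 ≠ (allPts x' j').1 := by
    refine Filter.eventually_all.2 fun j => Filter.eventually_all.2 fun j' => ?_
    by_cases h : (allPts x j).1 = (allPts x j').1
    · exact Filter.Eventually.of_forall fun _ h' => absurd h h'
    · filter_upwards [(isOpen_ne_fun (continuous_allPts j).fst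
        (continuous_allPts j').fst).mem_nhds h] with x' hx' _ using hx'
  have h2 : ∀ᶠ x' in 𝓝 x, ∀ j j', (allPts x j).2 < (allPts x j').2 →
      (allPts x' j).2 < (allPts x' j').2 := by
    refine Filter.eventually_all.2 fun j => Filter.eventually_all.2 fun j' => ?_
    by_cases h : (allPts x j).2 < (allPts x j').2
    · filter_upwards [(isOpen_lt (continuous_allPts j).snd
        (continuous_allPts j').snd).mem_nhds h] with x' hx' _ using hx'
    · exact Filter.Eventually.of_forall fun _ h' => absurd h' h
  filter_upwards [h1, h2] with x' h1 h2
  have hf : ∀ j j', (allPts x' j).1 = (allPts x' j').1 → (allPts x j).1 = (allPts x j').1 :=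
    fun j j' h => not_not.1 fun hne => h1 j j' hne h
  obtain ⟨hle, heq⟩ := card_image_le_of_factors hf
  refine ⟨by unfold numBase; convert hle, ?_⟩
  by_cases hlt : numBase x < numBase x'
  · exact Or.inr hlt
  refine Or.inl ?_
  have hcard : numBase x = numBase x' := le_antisymm (by unfold numBase; convert hle) (not_lt.1 hlt)
  have hg := heq (by unfold numBase at hcard; convert hcard)
  funext j j'
  refine propext ⟨fun h => ?_, fun h => ⟨hg _ _ h.1, h2 _ _ h.2⟩⟩
  have hne : j ≠ j' := by
    rintro rfl
    exact lt_irrefl _ h.2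
  exact (vertOrder_total hne (hf _ _ h.1)).resolve_right fun h' => lt_asymm h.2 (h2 _ _ h'.2)

variable [NormedSpace ℝ B]

lemma homotopic_of_separated {U : Type*} [TopologicalSpace U] {f g : C(U, RelConf c k)}
    (h : ∀ p j j', j ≠ j' →
      ((allPts (f p) j).1 = (allPts (g p) j).1 ∧ (allPts (f p) j').1 = (allPts (g p) j').1 ∧
        (allPts (f p) j).1 ≠ (allPts (f p) j').1) ∨
      ((allPts (f p) j).2 < (allPts (f p) j').2 ∧ (allPts (g p) j).2 < (allPts (g p) j').2) ∨
      ((allPts (f p) j').2 < (allPts (f p) j).2 ∧ (allPts (g p) j').2 < (allPts (g p) j).2)) :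
    f.Homotopic g := by
  let H : unitInterval × U → Fin k → B × ℝ := fun q =>
    (1 - (q.1 : ℝ)) • (f q.2).1 + (q.1 : ℝ) • (g q.2).1
  have hpts : ∀ q j, (Sum.elim (H q) c : Fin k ⊕ Fin m → B × ℝ) j =
      (1 - (q.1 : ℝ)) • allPts (f q.2) j + (q.1 : ℝ) • allPts (g q.2) j := by
    rintro q (a | i)
    · rfl
    · simp only [allPts, Sum.elim_inr]
      rw [← add_smul, sub_add_cancel, one_smul]
  have hlt : ∀ (s : unitInterval) {x y x' y' : ℝ}, x < y → x' < y' →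
      (1 - (s : ℝ)) * x + s * x' < (1 - (s : ℝ)) * y + s * y' := by
    intro s x y x' y' hxy hxy'
    have h0 := s.2.1
    have h1 := s.2.2
    rcases h0.eq_or_lt with h0 | h0
    · rw [← h0]; linarith
    · exact add_lt_add_of_le_of_lt (mul_le_mul_of_nonneg_left hxy.le (by linarith))
        (mul_lt_mul_of_pos_left hxy' h0)
  have hinj : ∀ q, Function.Injective (Sum.elim (H q) c) := by
    intro q j j' heq
    by_contra hne
    rw [hpts, hpts] at heq
    rcases h q.2 j j' hne with ⟨h1, h2, h3⟩ | ⟨h1, h2⟩ | ⟨h1, h2⟩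
    · have := congrArg Prod.fst heq
      simp only [Prod.fst_add, Prod.smul_fst, ← h1, ← h2] at this
      rw [← add_smul, ← add_smul, sub_add_cancel, one_smul, one_smul] at this
      exact h3 this
    · have := congrArg Prod.snd heq
      simp only [Prod.snd_add, Prod.smul_snd, smul_eq_mul] at this
      exact (hlt q.1 h1 h2).ne this
    · have := congrArg Prod.snd heq
      simp only [Prod.snd_add, Prod.smul_snd, smul_eq_mul] at this
      exact (hlt q.1 h1 h2).ne' this
  have hH : Continuous H := by fun_prop
  refine ⟨⟨⟨fun q => ⟨H q, hinj q⟩, hH.subtype_mk _⟩, fun p => ?_, fun p => ?_⟩⟩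
  · exact Subtype.ext (by simp [H])
  · exact Subtype.ext (by simp [H])

/-- Compatible configurations can be moved to a configuration with prescribed base points. -/
lemma exists_homotopic_const (hc : Function.Injective fun i => (c i).1) (x₀ : RelConf c k)
    (u : Fin k → B) : ∃ y : RelConf c k, (∀ a, (y.1 a).1 = u a) ∧
      ∀ {U : Type _} [TopologicalSpace U] (f : C(U, RelConf c k)),
        (∀ p, f p ∈ compatSet c (vertOrder x₀)) → f.Homotopic (ContinuousMap.const U y) := by
  obtain ⟨h, hL, hh⟩ := exists_heights x₀
  have hc' : Function.Injective c := fun i j hij => hc (congrArg Prod.fst hij)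
  refine ⟨⟨fun a => (u a, h a), injective_of_heights hc' hh u⟩, fun a => rfl, fun {U} _ f hf => ?_⟩
  let f' : C(U, RelConf c k) :=
    ⟨fun p => ⟨fun a => (((f p).1 a).1, h a), injective_of_heights hc' hh _⟩, by
      refine Continuous.subtype_mk (continuous_pi fun a => Continuous.prodMk ?_ continuous_const) _
      exact ((continuous_apply a).comp (continuous_subtype_val.comp f.continuous)).fst⟩
  have hf'1 : ∀ p j, (allPts (f' p) j).1 = (allPts (f p) j).1 := by
    rintro p (a | i) <;> rfl
  have hf'2 : ∀ p j, (allPts (f' p) j).2 =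
      (Sum.elim h fun i => (c i).2 : Fin k ⊕ Fin m → ℝ) j := by
    rintro p (a | i) <;> rfl
  refine ContinuousMap.Homotopic.trans (g := f') (homotopic_of_separated fun p j j' hne => ?_)
    (homotopic_of_separated fun p j j' hne => ?_)
  · simp only [hf'1, hf'2]
    by_cases h1 : vertOrder x₀ j j'
    · exact Or.inr (Or.inl ⟨(hf p j j').1 h1, hL _ _ h1⟩)
    by_cases h2 : vertOrder x₀ j' j
    · exact Or.inr (Or.inr ⟨(hf p j' j).1 h2, hL _ _ h2⟩)
    · exact Or.inl ⟨trivial, trivial, (hf p j j').2 hne h1 h2⟩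
  · have hy2 : ∀ j, (allPts (⟨fun a => (u a, h a), injective_of_heights hc' hh u⟩ : RelConf c k)
        j).2 = (Sum.elim h fun i => (c i).2 : Fin k ⊕ Fin m → ℝ) j := by
      rintro (a | i) <;> rfl
    simp only [hf'2, ContinuousMap.const_apply, hy2, and_self]
    rcases j with a | i
    · exact Or.inr (lt_or_gt_of_ne (hh a j' hne.symm))
    · rcases j' with a' | i'
      · exact Or.inr (lt_or_gt_of_ne (hh a' _ hne).symm)
      · exact Or.inl ⟨rfl, rfl, fun heq => hne (congrArg _ (hc heq))⟩

lemma hasPlan_empty {X : Type*} [TopologicalSpace X] : HasPlan (∅ : Set (X × X)) := by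
  have : fstMap (∅ : Set (X × X)) = sndMap ∅ := ContinuousMap.ext fun p => p.2.elim
  rw [HasPlan, this]

/-- The upper bound for configurations in the complement of finitely many points of a product with
the real line. -/
theorem tcCover_relConf [Nontrivial B] (hc : Function.Injective fun i => (c i).1) (hk : 0 < k) :
    TCCover (RelConf c k) (2 * (k + m - max m 1) + 1) := by
  have : Infinite B := Module.Free.infinite ℝ B
  let u' := ((Set.finite_range fun i => (c i).1).infinite_compl).natEmbedding
  let u : Fin k → B := fun a => u' a
  have hu : Function.Injective (Sum.elim u fun i => (c i).1) := by
    refine Function.Injective.sumElim ?_ hc fun a i h => (u' a).2 ⟨i, h.symm⟩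
    exact Subtype.val_injective.comp (u'.injective.comp Fin.val_injective)
  refine tcCover_of_levels (fun z => (vertOrder z.1, vertOrder z.2))
    (fun z => numBase z.1 + numBase z.2 - 2 * max m 1) (fun z => ?_) (fun z => ?_) ?_
  · have h1 := numBase_le z.1
    have h2 := numBase_le z.2
    have h3 := le_numBase hc hk z.1
    omega
  · have h1 := (continuous_fst.tendsto z).eventually (eventually_vertOrder z.1)
    have h2 := (continuous_snd.tendsto z).eventually (eventually_vertOrder z.2)
    filter_upwards [h1, h2] with z' h1 h2
    have h3 := le_numBase hc hk z.1
    have h4 := le_numBase hc hk z.2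
    rcases h1.2 with h5 | h5
    · rcases h2.2 with h6 | h6
      · exact Or.inl (by rw [h5, h6])
      · exact Or.inr (by omega)
    · exact Or.inr (by omega)
  · rintro ⟨L, L'⟩
    by_cases hex : ∃ z : RelConf c k × RelConf c k, (vertOrder z.1, vertOrder z.2) = (L, L')
    · obtain ⟨z, hz⟩ := hex
      obtain ⟨y, hy, hyh⟩ := exists_homotopic_const hc z.1 u
      obtain ⟨y', hy', hyh'⟩ := exists_homotopic_const hc z.2 u
      rw [Prod.mk.injEq] at hz
      refine ⟨compatSet c L ×ˢ compatSet c L',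
        (isOpen_compatSet L).prod (isOpen_compatSet L'), ?_, ?_⟩
      · rintro p hp
        rw [Prod.mk.injEq] at hp
        exact ⟨hp.1 ▸ mem_compatSet_vertOrder p.1, hp.2 ▸ mem_compatSet_vertOrder p.2⟩
      · have h1 := hyh (fstMap (compatSet c L ×ˢ compatSet c L')) fun p => hz.1 ▸ p.2.1
        have h2 := hyh' (sndMap (compatSet c L ×ˢ compatSet c L')) fun p => hz.2 ▸ p.2.2
        refine h1.trans (ContinuousMap.Homotopic.trans ?_ h2.symm)
        refine homotopic_of_separated fun p j j' hne => Or.inl ?_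
        have hb : ∀ j, (allPts y j).1 = (Sum.elim u fun i => (c i).1 : Fin k ⊕ Fin m → B) j := by
          rintro (a | i)
          exacts [hy a, rfl]
        have hb' : ∀ j, (allPts y' j).1 = (Sum.elim u fun i => (c i).1 : Fin k ⊕ Fin m → B) j := by
          rintro (a | i)
          exacts [hy' a, rfl]
        simp only [ContinuousMap.const_apply, hb, hb', true_and]
        exact hu.ne hne
    · exact ⟨∅, isOpen_empty, fun z hz => absurd ⟨z, hz⟩ hex, hasPlan_empty⟩

end UpperBound

section Transfer

variable {X Y : Type*} [TopologicalSpace X] [TopologicalSpace Y]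

lemma hasPlan_of_section {U : Set (X × X)} (s : C(↥U, C(unitInterval, X)))
    (hs : ∀ p : ↥U, (s p) 0 = (p : X × X).1 ∧ (s p) 1 = (p : X × X).2) : HasPlan U :=
  ⟨⟨⟨fun q => s q.2 q.1, by fun_prop⟩, fun p => (hs p).1, fun p => (hs p).2⟩⟩

lemma tcCover_of_homotopic_id {N : ℕ} (h : TCCover Y N) (f : C(X, Y)) (g : C(Y, X))
    (hgf : (ContinuousMap.id X).Homotopic (g.comp f)) : TCCover X N := by
  obtain ⟨U, hUo, hUc, hs⟩ := h
  refine tcCover_of_hasPlan (U := fun i => Prod.map f f ⁻¹' U i)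
    (fun i => (hUo i).preimage (f.continuous.prodMap f.continuous)) ?_ fun i => ?_
  · rw [← Set.preimage_iUnion, hUc, Set.preimage_univ]
  · obtain ⟨s, hs⟩ := hs i
    exact (hasPlan_of_section s hs).preimage f g hgf

variable {E V : Type*} [TopologicalSpace E] [TopologicalSpace V] {m k N : ℕ}

/-- An isotopy pushing the complement of the points `c i` into `S`, and keeping `S` inside itself,
transfers motion planners to the configurations in `S`. -/
lemma tcCover_conf_of_isotopy {c : Fin m → E} (hc : Function.Injective c) {S : Set E} (φ : E ≃ₜ V)
    (hS : ∀ z ∈ S, ∀ i, z ≠ c i) (R : unitInterval → {z // ∀ i, z ≠ c i} → E)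
    (hR : Continuous fun q : unitInterval × {z // ∀ i, z ≠ c i} => R q.1 q.2)
    (hinj : ∀ t, Function.Injective (R t)) (hR0 : ∀ z, R 0 z = z)
    (hRS : ∀ t z, z.1 ∈ S → R t z ∈ S) (hR1 : ∀ z, R 1 z ∈ S)
    (h : TCCover (RelConf (φ ∘ c) k) N) : TCCover (Conf S k) N := by
  let f : C(Conf S k, RelConf (φ ∘ c) k) :=
    ⟨fun x => ⟨fun a => φ (x.1 a), Function.Injective.sumElim
      (φ.injective.comp (Subtype.val_injective.comp x.2)) (φ.injective.comp hc)
      fun a i h => hS _ (x.1 a).2 i (φ.injective h)⟩, by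
        refine Continuous.subtype_mk (continuous_pi fun a => φ.continuous.comp ?_) _
        exact continuous_subtype_val.comp ((continuous_apply a).comp continuous_subtype_val)⟩
  have hne : ∀ (y : RelConf (φ ∘ c) k) a i, φ.symm (y.1 a) ≠ c i := fun y a i h => by
    have h1 : (Sum.elim y.1 (φ ∘ c) : Fin k ⊕ Fin m → V) (Sum.inl a) =
        (Sum.elim y.1 (φ ∘ c) : Fin k ⊕ Fin m → V) (Sum.inr i) := by
      rw [Sum.elim_inl, Sum.elim_inr, Function.comp_apply, ← h, φ.apply_symm_apply]
    exact Sum.inl_ne_inr (y.2 h1)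
  let pull : RelConf (φ ∘ c) k → Fin k → {z // ∀ i, z ≠ c i} :=
    fun y a => ⟨φ.symm (y.1 a), hne y a⟩
  have hpull : Continuous pull := continuous_pi fun a => Continuous.subtype_mk
    (φ.symm.continuous.comp ((continuous_apply a).comp continuous_subtype_val)) _
  have hpinj : ∀ y, Function.Injective (pull y) := fun y a b hab => by
    have h1 := φ.symm.injective (congrArg Subtype.val hab)
    exact Sum.inl_injective (y.2 (a₁ := Sum.inl a) (a₂ := Sum.inl b) h1)
  let g : C(RelConf (φ ∘ c) k, Conf S k) :=
    ⟨fun y => ⟨fun a => ⟨R 1 (pull y a), hR1 _⟩, fun a b hab =>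
      hpinj y (hinj 1 (congrArg Subtype.val hab))⟩, by
        refine Continuous.subtype_mk (continuous_pi fun a => Continuous.subtype_mk ?_ _) _
        exact hR.comp (continuous_const.prodMk ((continuous_apply a).comp hpull))⟩
  have hpf : ∀ x a, pull (f x) a = ⟨(x.1 a).1, hS _ (x.1 a).2⟩ := fun x a =>
    Subtype.ext (φ.symm_apply_apply _)
  refine tcCover_of_homotopic_id h f g ⟨⟨⟨fun q => ⟨fun a => ⟨R q.1 (pull (f q.2) a), ?_⟩, ?_⟩, ?_⟩,
    fun x => ?_, fun x => rfl⟩⟩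
  · rw [hpf]
    exact hRS _ _ (q.2.1 a).2
  · exact fun a b hab => hpinj _ (hinj _ (congrArg Subtype.val hab))
  · refine Continuous.subtype_mk (continuous_pi fun a => Continuous.subtype_mk ?_ _) _
    exact hR.comp (continuous_fst.prodMk
      ((continuous_apply a).comp (hpull.comp (f.continuous.comp continuous_snd))))
  · refine Subtype.ext (funext fun a => Subtype.ext ?_)
    exact (hR0 _).trans (congrArg Subtype.val (hpf x a))

end Transfer

section Splitting

/-- Finitely many points of a space of dimension at least two have distinct projections along some
direction. -/
lemma exists_equiv_prod_real {E : Type*} [NormedAddCommGroup E] [NormedSpace ℝ E]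
    [FiniteDimensional ℝ E] (hE : 1 < Module.finrank ℝ E) {m : ℕ} {c : Fin m → E}
    (hc : Function.Injective c) : ∃ (B : Submodule ℝ E) (φ : E ≃L[ℝ] B × ℝ),
      Nontrivial B ∧ Function.Injective fun i => (φ (c i)).1 := by
  have hspan : ∀ w : E, Submodule.span ℝ {w} ≠ ⊤ := fun w h => by
    have h1 := finrank_span_le_card (R := ℝ) {w}
    rw [h, finrank_top, Set.toFinset_singleton, Finset.card_singleton] at h1
    omega
  obtain ⟨v, hv⟩ : ∃ v : E, ∀ p : Option (Fin m × Fin m),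
      v ∉ Submodule.span ℝ {p.elim 0 fun p => c p.1 - c p.2} := by
    by_contra! hcon
    obtain ⟨p, hp⟩ := Subspace.exists_eq_top_of_iUnion_eq_univ (k := ℝ) (E := E)
      (p := fun p : Option (Fin m × Fin m) =>
        Submodule.span ℝ {p.elim 0 fun p => c p.1 - c p.2})
      (Set.eq_univ_of_forall fun v => Set.mem_iUnion.2 (hcon v))
    exact hspan _ hp
  have hv0 : v ≠ 0 := by
    rintro rfl
    exact hv none (zero_mem _)
  obtain ⟨B, hB⟩ := Submodule.exists_isCompl (Submodule.span ℝ {v})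
  let ψ : E ≃ₗ[ℝ] B × ℝ := (Submodule.prodEquivOfIsCompl B _ hB.symm).symm.trans
    (LinearEquiv.prodCongr (LinearEquiv.refl ℝ B) (LinearEquiv.toSpanNonzeroSingleton ℝ E v hv0).symm)
  have hψ : ∀ b s, ψ.symm (b, s) = (b : E) + s • v := fun b s => by
    simp [ψ]
  have hker : ∀ x, (ψ x).1 = 0 → x = (ψ x).2 • v := fun x hx => by
    have := hψ (ψ x).1 (ψ x).2
    rw [Prod.mk.eta, ψ.symm_apply_apply, hx] at this
    simpa using this
  refine ⟨B, ψ.toContinuousLinearEquiv, ?_, fun i j hij => ?_⟩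
  · by_contra hnt
    rw [not_nontrivial_iff_subsingleton] at hnt
    refine hspan v (Submodule.eq_top_iff'.2 fun x => ?_)
    exact Submodule.mem_span_singleton.2 ⟨_, (hker x (Subsingleton.elim _ _)).symm⟩
  · by_contra hne
    have h1 : (ψ (c i - c j)).1 = 0 := by
      rw [map_sub, Prod.fst_sub, sub_eq_zero]
      exact hij
    have h2 := hker _ h1
    have h3 : (ψ (c i - c j)).2 ≠ 0 := fun h => by
      rw [h, zero_smul, sub_eq_zero] at h2
      exact hne (hc h2)
    refine hv (some (i, j)) (Submodule.mem_span_singleton.2 ⟨(ψ (c i - c j)).2⁻¹, ?_⟩)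
    change _ • (c i - c j) = v
    nth_rewrite 2 [h2]
    rw [inv_smul_smul₀ h3]

end Splitting

section Isotopy

lemma le_norm_sub_of_lt {E : Type*} [NormedAddCommGroup E] {m : ℕ} {c : Fin m → E}
    {R : Fin m → ℝ} (hd : ∀ i j, i ≠ j → R i + R j ≤ ‖c i - c j‖)
    {z : E} {i j : Fin m} (hij : i ≠ j) (h : ‖z - c i‖ < R i) : R j ≤ ‖z - c j‖ := by
  have h1 := hd i j hij
  have h2 := norm_sub_le_norm_sub_add_norm_sub (c i) z (c j)
  rw [norm_sub_rev (c i) z] at h2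
  linarith

variable {E : Type*} [NormedAddCommGroup E] [NormedSpace ℝ E]

lemma eq_of_radial {f : ℝ → ℝ} {A : Set ℝ} (hf : ∀ x ∈ A, 0 < f x)
    (hmono : StrictMonoOn (fun x => f x * x) A) {v w : E} (hv : ‖v‖ ∈ A) (hw : ‖w‖ ∈ A)
    (h : f ‖v‖ • v = f ‖w‖ • w) : v = w := by
  have h1 := congrArg norm h
  rw [norm_smul, norm_smul, Real.norm_of_nonneg (hf _ hv).le,
    Real.norm_of_nonneg (hf _ hw).le] at h1
  rw [← hmono.injOn hv hw h1] at h
  exact smul_right_injective E (hf _ hv).ne' h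

variable {m : ℕ} (c : Fin m → E) (r R : Fin m → ℝ)

/-- The isotopy pushing the punctured balls of radius `R i` off the balls of radius `r i`. -/
noncomputable def innerPush (t : ℝ) (z : E) : E :=
  z + t • ∑ i, max 0 (r i / ‖z - c i‖ - r i / R i) • (z - c i)

/-- The isotopy contracting the space radially outside the ball of radius `R₀`. -/
noncomputable def outerPush (r₀ R₀ t : ℝ) (z : E) : E :=
  (1 + t * max 0 (‖z‖ - R₀) / r₀)⁻¹ • z

variable {c r R}

lemma innerPush_of_le {z : E} (hr : ∀ i, 0 < r i) (hR : ∀ i, r i < R i)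
    (h : ∀ i, R i ≤ ‖z - c i‖) (t : ℝ) : innerPush c r R t z = z := by
  rw [innerPush, Finset.sum_eq_zero, smul_zero, add_zero]
  intro i _
  rw [max_eq_left, zero_smul]
  exact sub_nonpos.2 (div_le_div_of_nonneg_left (hr i).le ((hr i).trans (hR i)) (h i))

lemma innerPush_sub_of_lt (hr : ∀ i, 0 < r i) (hR : ∀ i, r i < R i)
    (hd : ∀ i j, i ≠ j → R i + R j ≤ ‖c i - c j‖) {z : E} {i : Fin m} (h : ‖z - c i‖ < R i)
    (hz : z ≠ c i) (t : ℝ) :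
    innerPush c r R t z - c i = (1 + t * (r i / ‖z - c i‖ - r i / R i)) • (z - c i) := by
  have hpos : 0 < ‖z - c i‖ := norm_pos_iff.2 (sub_ne_zero.2 hz)
  rw [innerPush, Finset.sum_eq_single i, max_eq_right]
  · rw [add_smul, one_smul, smul_smul, add_sub_right_comm]
  · exact sub_nonneg.2 (div_le_div_of_nonneg_left (hr i).le hpos h.le)
  · intro j _ hj
    rw [max_eq_left, zero_smul]
    exact sub_nonpos.2 (div_le_div_of_nonneg_left (hr j).le ((hr j).trans (hR j))
      (le_norm_sub_of_lt hd hj.symm h))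
  · simp

lemma norm_innerPush_sub_of_lt (hr : ∀ i, 0 < r i) (hR : ∀ i, r i < R i)
    (hd : ∀ i j, i ≠ j → R i + R j ≤ ‖c i - c j‖) {z : E} {i : Fin m} (h : ‖z - c i‖ < R i)
    (hz : z ≠ c i) {t : ℝ} (ht : 0 ≤ t) :
    ‖innerPush c r R t z - c i‖ = ‖z - c i‖ + t * (r i - r i / R i * ‖z - c i‖) := by
  have hpos : 0 < ‖z - c i‖ := norm_pos_iff.2 (sub_ne_zero.2 hz)
  have h1 : 0 ≤ r i / ‖z - c i‖ - r i / R i :=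
    sub_nonneg.2 (div_le_div_of_nonneg_left (hr i).le hpos h.le)
  rw [innerPush_sub_of_lt hr hR hd h hz, norm_smul, Real.norm_of_nonneg (by positivity)]
  field_simp

lemma norm_innerPush_sub_lt (hr : ∀ i, 0 < r i) (hR : ∀ i, r i < R i)
    (hd : ∀ i j, i ≠ j → R i + R j ≤ ‖c i - c j‖) {z : E} {i : Fin m} (h : ‖z - c i‖ < R i)
    (hz : z ≠ c i) {t : ℝ} (ht : t ∈ Set.Icc (0 : ℝ) 1) :
    ‖innerPush c r R t z - c i‖ < R i := by
  have hRi := (hr i).trans (hR i)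
  rw [norm_innerPush_sub_of_lt hr hR hd h hz ht.1]
  have h1 : r i / R i < 1 := (div_lt_one hRi).2 (hR i)
  have h2 : r i - r i / R i * ‖z - c i‖ = r i / R i * (R i - ‖z - c i‖) := by field_simp
  have h3 : t * (r i / R i) < 1 := lt_of_le_of_lt
    (mul_le_of_le_one_left (div_pos (hr i) hRi).le ht.2) h1
  rw [h2]
  nlinarith

lemma le_norm_innerPush_sub (hr : ∀ i, 0 < r i) (hR : ∀ i, r i < R i)
    (hd : ∀ i j, i ≠ j → R i + R j ≤ ‖c i - c j‖) {z : E} (hz : ∀ i, z ≠ c i) {t : ℝ}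
    (ht : t ∈ Set.Icc (0 : ℝ) 1) (h : t = 1 ∨ ∀ i, r i ≤ ‖z - c i‖) (i : Fin m) :
    r i ≤ ‖innerPush c r R t z - c i‖ := by
  by_cases hj : ∃ j, ‖z - c j‖ < R j
  · obtain ⟨j, hj⟩ := hj
    by_cases hij : j = i
    · subst hij
      have hRi := (hr j).trans (hR j)
      rw [norm_innerPush_sub_of_lt hr hR hd hj (hz j) ht.1]
      have h1 : r j / R j < 1 := (div_lt_one hRi).2 (hR j)
      have h2 : 0 ≤ r j - r j / R j * ‖z - c j‖ := by
        have : r j - r j / R j * ‖z - c j‖ = r j / R j * (R j - ‖z - c j‖) := by field_simp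
        rw [this]
        exact mul_nonneg (div_pos (hr j) hRi).le (sub_nonneg.2 hj.le)
      rcases h with rfl | h
      · nlinarith [norm_nonneg (z - c j)]
      · nlinarith [h j, mul_nonneg ht.1 h2]
    · exact (hR i).le.trans
        (le_norm_sub_of_lt hd hij (norm_innerPush_sub_lt hr hR hd hj (hz j) ht))
  · push Not at hj
    rw [innerPush_of_le hr hR hj]
    exact (hR i).le.trans (hj i)

lemma innerPush_inj (hr : ∀ i, 0 < r i) (hR : ∀ i, r i < R i)
    (hd : ∀ i j, i ≠ j → R i + R j ≤ ‖c i - c j‖) {t : ℝ} (ht : t ∈ Set.Icc (0 : ℝ) 1) {z w : E}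
    (hz : ∀ i, z ≠ c i) (hw : ∀ i, w ≠ c i)
    (h : innerPush c r R t z = innerPush c r R t w) : z = w := by
  have key : ∀ {z w : E}, (∀ i, z ≠ c i) → (∀ i, w ≠ c i) →
      innerPush c r R t z = innerPush c r R t w → ∀ i, ‖z - c i‖ < R i → z = w := by
    intro z w hz hw h i hi
    have h1 := norm_innerPush_sub_lt hr hR hd hi (hz i) ht
    have hwi : ‖w - c i‖ < R i := by
      rw [h] at h1
      by_contra hcon
      by_cases hj : ∃ j, ‖w - c j‖ < R j
      · obtain ⟨j, hj⟩ := hj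
        have hji : j ≠ i := by
          rintro rfl
          exact hcon hj
        exact absurd (le_norm_sub_of_lt hd hji (norm_innerPush_sub_lt hr hR hd hj (hw j) ht))
          (not_le.2 h1)
      · push Not at hj
        rw [innerPush_of_le hr hR hj] at h1
        exact hcon h1
    have h2 := congrArg (· - c i) h
    simp only [innerPush_sub_of_lt hr hR hd hi (hz i), innerPush_sub_of_lt hr hR hd hwi (hw i)]
      at h2
    have hRi := (hr i).trans (hR i)
    refine sub_left_injective (eq_of_radial (f := fun x => 1 + t * (r i / x - r i / R i))
      (A := Set.Ioo 0 (R i)) ?_ ?_ ⟨norm_pos_iff.2 (sub_ne_zero.2 (hz i)), hi⟩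
      ⟨norm_pos_iff.2 (sub_ne_zero.2 (hw i)), hwi⟩ h2)
    · intro x hx
      have := sub_nonneg.2 (div_le_div_of_nonneg_left (hr i).le hx.1 hx.2.le)
      have := mul_nonneg ht.1 this
      linarith
    · have h3 : t * (r i / R i) < 1 := lt_of_le_of_lt
        (mul_le_of_le_one_left (div_pos (hr i) hRi).le ht.2) ((div_lt_one hRi).2 (hR i))
      have h4 : ∀ x ∈ Set.Ioo 0 (R i), (1 + t * (r i / x - r i / R i)) * x =
          t * r i + (1 - t * (r i / R i)) * x := by
        intro x hx
        have := hx.1.ne'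
        field_simp
        ring
      intro x hx y hy hxy
      simp only [h4 x hx, h4 y hy]
      nlinarith
  by_cases hzi : ∃ i, ‖z - c i‖ < R i
  · obtain ⟨i, hi⟩ := hzi
    exact key hz hw h i hi
  by_cases hwi : ∃ i, ‖w - c i‖ < R i
  · obtain ⟨i, hi⟩ := hwi
    exact (key hw hz h.symm i hi).symm
  push Not at hzi hwi
  rwa [innerPush_of_le hr hR hzi, innerPush_of_le hr hR hwi] at h

section Outer

variable {r₀ R₀ t : ℝ}

lemma outerPush_of_le {z : E} (h : ‖z‖ ≤ R₀) : outerPush r₀ R₀ t z = z := by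
  simp [outerPush, max_eq_left (sub_nonpos.2 h)]

lemma one_le_outerScale (h₀ : 0 < r₀) (ht : 0 ≤ t) (x : ℝ) :
    1 ≤ 1 + t * max 0 (x - R₀) / r₀ := by
  have : 0 ≤ t * max 0 (x - R₀) / r₀ := by positivity
  linarith

lemma norm_outerPush (h₀ : 0 < r₀) (ht : 0 ≤ t) (z : E) :
    ‖outerPush r₀ R₀ t z‖ = (1 + t * max 0 (‖z‖ - R₀) / r₀)⁻¹ * ‖z‖ := by
  have := one_le_outerScale (R₀ := R₀) h₀ ht ‖z‖
  rw [outerPush, norm_smul, Real.norm_of_nonneg (by positivity)]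

lemma norm_outerPush_le_norm (h₀ : 0 < r₀) (ht : 0 ≤ t) (z : E) :
    ‖outerPush r₀ R₀ t z‖ ≤ ‖z‖ := by
  rw [norm_outerPush h₀ ht]
  exact mul_le_of_le_one_left (norm_nonneg _) (inv_le_one_of_one_le₀ (one_le_outerScale h₀ ht _))

lemma norm_outerPush_one_le (h₀ : 0 < r₀) (hR : R₀ < r₀) (z : E) :
    ‖outerPush r₀ R₀ 1 z‖ ≤ r₀ := by
  have h1 := one_le_outerScale (R₀ := R₀) h₀ zero_le_one ‖z‖
  rw [norm_outerPush h₀ zero_le_one, inv_mul_le_iff₀ (by linarith), add_mul, one_mul, one_mul,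
    div_mul_cancel₀ _ h₀.ne']
  linarith [le_max_right 0 (‖z‖ - R₀)]

lemma lt_norm_outerPush (h₀ : 0 < r₀) (hR : R₀ < r₀) (hR' : 0 < R₀)
    (ht : t ∈ Set.Icc (0 : ℝ) 1) {z : E} (h : R₀ < ‖z‖) : R₀ < ‖outerPush r₀ R₀ t z‖ := by
  have h1 := one_le_outerScale (R₀ := R₀) h₀ ht.1 ‖z‖
  rw [norm_outerPush h₀ ht.1, lt_inv_mul_iff₀ (by linarith), max_eq_right (by linarith)]
  have h3 : t * (R₀ / r₀) < 1 := lt_of_le_of_lt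
    (mul_le_of_le_one_left (by positivity) ht.2) ((div_lt_one h₀).2 hR)
  have h4 : (1 + t * (‖z‖ - R₀) / r₀) * R₀ = R₀ + t * (R₀ / r₀) * (‖z‖ - R₀) := by ring
  rw [h4]
  nlinarith

lemma outerPush_injective (h₀ : 0 < r₀) (hR : R₀ < r₀) (hR' : 0 < R₀)
    (ht : t ∈ Set.Icc (0 : ℝ) 1) : Function.Injective (outerPush r₀ R₀ t : E → E) := by
  intro z w h
  refine eq_of_radial (f := fun x => (1 + t * max 0 (x - R₀) / r₀)⁻¹) (A := Set.Ici 0)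
    (fun x _ => ?_) ?_ (norm_nonneg z) (norm_nonneg w) h
  · have := one_le_outerScale (R₀ := R₀) h₀ ht.1 x
    positivity
  · intro x hx y hy hxy
    have h1 := one_le_outerScale (R₀ := R₀) h₀ ht.1 x
    have h2 := one_le_outerScale (R₀ := R₀) h₀ ht.1 y
    have h3 : t * (R₀ / r₀) < 1 := lt_of_le_of_lt
      (mul_le_of_le_one_left (by positivity) ht.2) ((div_lt_one h₀).2 hR)
    have hx0 : 0 ≤ x := hx
    simp only
    rw [inv_mul_lt_iff₀ (by linarith), mul_left_comm, lt_inv_mul_iff₀ (by linarith)]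
    have h5 : 0 ≤ t / r₀ := div_nonneg ht.1 h₀.le
    rcases le_total x R₀ with hxR | hxR
    · rw [max_eq_left (sub_nonpos.2 hxR)]
      rcases le_total y R₀ with hyR | hyR
      · simpa [max_eq_left (sub_nonpos.2 hyR)] using hxy
      · rw [max_eq_right (sub_nonneg.2 hyR)]
        have h6 : t / r₀ * x ≤ t * (R₀ / r₀) := by
          rw [mul_div_assoc', div_mul_eq_mul_div]
          gcongr
          exact ht.1
        have h7 : (1 + t * (y - R₀) / r₀) * x = x + t / r₀ * x * (y - R₀) := by ring
        have h8 : t / r₀ * x * (y - R₀) ≤ t / r₀ * x * (y - x) := by gcongr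
        rw [h7, mul_zero, zero_div, add_zero, one_mul]
        nlinarith
    · have hyR := hxR.trans hxy.le
      rw [max_eq_right (sub_nonneg.2 hyR), max_eq_right (sub_nonneg.2 hxR)]
      have h6 : (1 + t * (x - R₀) / r₀) * y - (1 + t * (y - R₀) / r₀) * x =
        (1 - t * (R₀ / r₀)) * (y - x) := by ring
      nlinarith

end Outer

end Isotopy

section SphereWorldUpper

variable {E V : Type*} [NormedAddCommGroup E] {m k N : ℕ} {c : Fin m → E} {r : Fin m → ℝ} {r₀ : ℝ}

lemma exists_margin (hr₀ : 0 < r₀) (hin : ∀ i, ‖c i‖ + r i < r₀)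
    (hdisj : ∀ i j, i ≠ j → r i + r j < ‖c i - c j‖) :
    ∃ δ > 0, δ < r₀ ∧ (∀ i, ‖c i‖ + (r i + δ) ≤ r₀) ∧
      ∀ i j, i ≠ j → (r i + δ) + (r j + δ) ≤ ‖c i - c j‖ := by
  have h1 : ∀ᶠ δ in 𝓝[>] (0 : ℝ), δ < r₀ :=
    (eventually_lt_nhds hr₀).filter_mono nhdsWithin_le_nhds
  have h2 : ∀ i, ∀ᶠ δ in 𝓝[>] (0 : ℝ), ‖c i‖ + (r i + δ) ≤ r₀ := fun i => by
    filter_upwards [(eventually_lt_nhds (sub_pos.2 (hin i))).filter_mono nhdsWithin_le_nhds]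
      with δ hδ
    linarith
  have h3 : ∀ i j, ∀ᶠ δ in 𝓝[>] (0 : ℝ), i ≠ j → (r i + δ) + (r j + δ) ≤ ‖c i - c j‖ := by
    intro i j
    by_cases hij : i = j
    · exact Filter.Eventually.of_forall fun δ h => absurd hij h
    · filter_upwards [(eventually_lt_nhds (half_pos (sub_pos.2 (hdisj i j hij)))).filter_mono
        nhdsWithin_le_nhds] with δ hδ _
      linarith
  have h0 : ∀ᶠ δ in 𝓝[>] (0 : ℝ), 0 < δ := self_mem_nhdsWithin
  obtain ⟨δ, hδ, hδ1, hδ2, hδ3⟩ := (h0.and (h1.and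
    ((Filter.eventually_all.2 h2).and
      (Filter.eventually_all.2 fun i => Filter.eventually_all.2 (h3 i))))).exists
  exact ⟨δ, hδ, hδ1, hδ2, hδ3⟩

lemma mem_sphereWorld {z : E} : z ∈ Metric.closedBall (0 : E) r₀ \ ⋃ i, Metric.ball (c i) (r i) ↔
    ‖z‖ ≤ r₀ ∧ ∀ i, r i ≤ ‖z - c i‖ := by
  simp [dist_eq_norm]

/-- Motion planners for configurations in the complement of the centres transfer to the sphere
world. -/
lemma tcCover_conf_sphereWorld [NormedSpace ℝ E] [TopologicalSpace V] (hr₀ : 0 < r₀)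
    (hr : ∀ i, 0 < r i) (hin : ∀ i, ‖c i‖ + r i < r₀)
    (hdisj : ∀ i j, i ≠ j → r i + r j < ‖c i - c j‖) (φ : E ≃ₜ V)
    (h : TCCover (RelConf (φ ∘ c) k) N) :
    TCCover (Conf ↥(Metric.closedBall (0 : E) r₀ \ ⋃ i, Metric.ball (c i) (r i)) k) N := by
  obtain ⟨δ, hδ, hδ₀, hin', hd⟩ := exists_margin hr₀ hin hdisj
  have hR : ∀ i, r i < r i + δ := fun i => by linarith
  have hR₀ : r₀ - δ < r₀ := by linarith
  have hR₀' : 0 < r₀ - δ := by linarith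
  have hc : Function.Injective c := fun i j hij => by
    by_contra hne
    have := hdisj i j hne
    rw [hij, sub_self, norm_zero] at this
    linarith [hr i, hr j]
  have houter : ∀ (t : unitInterval) (w : E), (∀ i, r i ≤ ‖w - c i‖) →
      ∀ i, r i ≤ ‖outerPush r₀ (r₀ - δ) t w - c i‖ := by
    intro t w hw i
    rcases le_or_gt ‖w‖ (r₀ - δ) with h1 | h1
    · rw [outerPush_of_le h1]
      exact hw i
    · have h2 := lt_norm_outerPush hr₀ hR₀ hR₀' t.2 h1
      have h3 := norm_sub_norm_le (outerPush r₀ (r₀ - δ) t w) (c i)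
      linarith [hin' i]
  refine tcCover_conf_of_isotopy hc φ (fun z hz i hzi => ?_)
    (fun t z => outerPush r₀ (r₀ - δ) t (innerPush c r (fun i => r i + δ) t z)) ?_ ?_ ?_ ?_ ?_ h
  · have := (mem_sphereWorld.1 hz).2 i
    rw [hzi, sub_self, norm_zero] at this
    exact absurd this (not_le.2 (hr i))
  · have h1 : Continuous fun q : unitInterval × {z // ∀ i, z ≠ c i} =>
        innerPush c r (fun i => r i + δ) q.1 q.2 := by
      have hne : ∀ (q : unitInterval × {z // ∀ i, z ≠ c i}) i, ‖(q.2 : E) - c i‖ ≠ 0 :=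
        fun q i => norm_ne_zero_iff.2 (sub_ne_zero.2 (q.2.2 i))
      unfold innerPush
      fun_prop (disch := exact fun q => hne q _)
    have hne : ∀ q : unitInterval × {z // ∀ i, z ≠ c i},
        1 + (q.1 : ℝ) * max 0 (‖innerPush c r (fun i => r i + δ) q.1 q.2‖ - (r₀ - δ)) / r₀ ≠ 0 :=
      fun q => (zero_lt_one.trans_le (one_le_outerScale hr₀ q.1.2.1 _)).ne'
    exact Continuous.smul (Continuous.inv₀ (by fun_prop) hne) h1
  · intro t z w hzw
    exact Subtype.ext (innerPush_inj hr hR hd t.2 z.2 w.2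
      (outerPush_injective hr₀ hR₀ hR₀' t.2 hzw))
  · intro z
    simp [outerPush, innerPush]
  · intro t z hz
    rw [mem_sphereWorld] at hz ⊢
    refine ⟨(norm_outerPush_le_norm hr₀ t.2.1 _).trans ?_,
      houter t _ (le_norm_innerPush_sub hr hR hd z.2 t.2 (Or.inr hz.2))⟩
    by_cases hi : ∃ i, ‖(z : E) - c i‖ < r i + δ
    · obtain ⟨i, hi⟩ := hi
      have h1 := norm_innerPush_sub_lt hr hR hd hi (z.2 i) t.2
      have h2 := norm_sub_norm_le (innerPush c r (fun i => r i + δ) t z) (c i)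
      linarith [hin' i]
    · push Not at hi
      rw [innerPush_of_le hr hR hi]
      exact hz.1
  · intro z
    rw [mem_sphereWorld]
    exact ⟨norm_outerPush_one_le hr₀ hR₀ _,
      houter 1 _ (le_norm_innerPush_sub hr hR hd z.2 ⟨zero_le_one, le_rfl⟩ (Or.inl rfl))⟩

end SphereWorldUpper

section SphereWorldLower

variable {e K k : ℕ}

/-- The configuration of points on concentric spheres about `p` with given directions. -/
def sphereConf {E : Type*} [NormedAddCommGroup E] [NormedSpace ℝ E] {S : Set E} {p : E}
    {ρ : Fin k → ℝ} (h₀ : ∀ a, 0 ≤ ρ a) (hρ : Function.Injective ρ)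
    (hS : ∀ a w, ‖w‖ = 1 → p + ρ a • w ∈ S) (w : Fin k → Metric.sphere (0 : E) 1) : Conf S k :=
  ⟨fun a => ⟨p + ρ a • (w a : E), hS a _ (by simp)⟩, fun a b hab => hρ <| by
    have h1 := congrArg norm (add_left_cancel (congrArg Subtype.val hab))
    simpa [norm_smul, abs_of_nonneg (h₀ _)] using h1⟩

/-- A configuration space containing the configurations on concentric spheres, `K` of which have
positive radius, admits no small motion planning cover. -/
lemma not_tcCover_conf (he : Even (e + 1)) (hK : 0 < K) {S : Set (EuclideanSpace ℝ (Fin (e + 2)))}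
    {p : EuclideanSpace ℝ (Fin (e + 2))} {ρ : Fin k → ℝ} (h₀ : ∀ a, 0 ≤ ρ a)
    (hρ : Function.Injective ρ) (hS : ∀ a w, ‖w‖ = 1 → p + ρ a • w ∈ S) {τ : Fin K → Fin k}
    (hτ : Function.Injective τ) (hτρ : ∀ j, 0 < ρ (τ j))
    {q : Conf S k → EuclideanSpace ℝ (Fin (e + 2))} (hq : Continuous q)
    (hqne : ∀ x j, (x.1 (τ j) : EuclideanSpace ℝ (Fin (e + 2))) ≠ q x)
    (hqp : ∀ w, q (sphereConf h₀ hρ hS w) = p) : ¬ TCCover (Conf S k) (2 * K) := by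
  let y : (Fin (e + 1) → Circle) → EuclideanSpace ℝ (Fin (e + 2)) :=
    fun θ => WithLp.toLp 2 (sphereMap θ)
  have hy0 : ∀ θ, ‖y θ‖ ≠ 0 := fun θ => norm_ne_zero_iff.2 fun h =>
    sphereMap_ne_zero θ ((WithLp.toLp_eq_zero 2).1 h)
  have hy : Continuous y := (PiLp.continuous_toLp 2 _).comp continuous_sphereMap
  let w : (Fin (e + 1) → Circle) → Metric.sphere (0 : EuclideanSpace ℝ (Fin (e + 2))) 1 :=
    fun θ => ⟨‖y θ‖⁻¹ • y θ, by simp [norm_smul, hy0]⟩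
  have hw : Continuous w := ((hy.norm.inv₀ hy0).smul hy).subtype_mk _
  have : Nonempty (Fin K) := ⟨⟨0, hK⟩⟩
  let F : (Fin K → Fin (e + 1) → Circle) → Conf S k :=
    fun θ => sphereConf h₀ hρ hS fun a => w (θ (Function.invFun τ a))
  have hF : Continuous F := by
    refine Continuous.subtype_mk (continuous_pi fun a => Continuous.subtype_mk ?_ _) _
    exact continuous_const.add ((continuous_subtype_val.comp
      (hw.comp (continuous_apply (Function.invFun τ a)))).const_smul (ρ a))
  refine not_tcCover_of_sphereMap he hK hF
    (g := fun j x => (x.1 (τ j) - q x : EuclideanSpace ℝ (Fin (e + 2))).ofLp)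
    (fun j => ?_) (fun j x h => ?_) fun θ j => ⟨ρ (τ j) * ‖y (θ j)‖⁻¹, ?_, ?_⟩
  · exact (PiLp.continuous_ofLp 2 _).comp ((continuous_subtype_val.comp
      ((continuous_apply _).comp continuous_subtype_val)).sub hq)
  · exact hqne x j (sub_eq_zero.1 ((WithLp.ofLp_eq_zero 2).1 h))
  · exact mul_pos (hτρ j) (inv_pos.2 ((norm_nonneg _).lt_of_ne' (hy0 _)))
  · have h1 : ((F θ).1 (τ j) - q (F θ) : EuclideanSpace ℝ (Fin (e + 2))) =
        (ρ (τ j) * ‖y (θ j)‖⁻¹) • y (θ j) := by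
      have h2 : q (F θ) = p := hqp _
      rw [h2]
      simp only [F, sphereConf, w, Function.leftInverse_invFun hτ j, add_sub_cancel_left,
        smul_smul]
    simp only [h1]
    rfl

end SphereWorldLower

end SphereWorld

open SphereWorld

/-- Topological complexity of the collision-free motion planning problem on an
odd-dimensional sphere world. -/
theorem stmt12 (n m k : ℕ) (hn : 3 ≤ n) (hnodd : Odd n) (hk : 2 ≤ k)
    (r0 : ℝ) (hr0 : 0 < r0)
    (c : Fin m → EuclideanSpace ℝ (Fin n)) (r : Fin m → ℝ) (hr : ∀ i, 0 < r i)
    (hin : ∀ i, ‖c i‖ + r i < r0)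
    (hdisj : ∀ i j, i ≠ j → r i + r j < ‖c i - c j‖) :
    TopologicalComplexity
      (Conf (↥(Metric.closedBall (0 : EuclideanSpace ℝ (Fin n)) r0 \
        ⋃ i, Metric.ball (c i) (r i))) k)
      = if m = 0 then ((2 * k - 1 : ℕ) : ℕ∞)
        else ((2 * k + 1 : ℕ) : ℕ∞) := by
  obtain ⟨e, rfl⟩ : ∃ e, n = e + 2 := ⟨n - 2, by omega⟩
  have he : Even (e + 1) := by
    rcases hnodd with ⟨l, hl⟩
    exact ⟨l, by omega⟩
  have hc : Function.Injective c := fun i j hij => by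
    by_contra hne
    have := hdisj i j hne
    rw [hij, sub_self, norm_zero] at this
    linarith [hr i, hr j]
  obtain ⟨B, φ, hB, hφ⟩ := exists_equiv_prod_real (by simp) hc
  have hupper := tcCover_conf_sphereWorld hr0 hr hin hdisj φ.toHomeomorph
    (tcCover_relConf (c := φ ∘ c) hφ (by omega : 0 < k))
  have hTC : ∀ {X : Type} [TopologicalSpace X] {N : ℕ}, TCCover X (N + 1) → ¬ TCCover X N →
      TopologicalComplexity X = ((N + 1 : ℕ) : ℕ∞) := by
    intro X _ N h1 h2
    refine le_antisymm (sInf_le ⟨_, rfl, h1⟩) (le_sInf ?_)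
    rintro _ ⟨N', rfl, hN'⟩
    refine Nat.cast_le.2 (Nat.lt_of_not_le fun hle => h2 (tcCover_mono hN' hle))
  have hsub : ∀ {s : ℝ} {k' : ℕ}, 0 < s → Function.Injective fun a : Fin k' => s * (a : ℝ) :=
    fun hs a b hab => Fin.ext (Nat.cast_injective (mul_left_cancel₀ hs.ne' hab))
  split_ifs with hm
  · subst hm
    obtain ⟨K, rfl⟩ : ∃ K, k = K + 1 := ⟨k - 1, by omega⟩
    have hval : 2 * (K + 1) - 1 = 2 * K + 1 := by omega
    rw [hval]
    refine hTC (by simpa using hupper) ?_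
    have hs : 0 < r0 / (K + 1) := by positivity
    refine not_tcCover_conf he (by omega) (p := 0) (ρ := fun a => r0 / (K + 1) * a)
      (fun a => by positivity) (hsub hs) (fun a w hw => mem_sphereWorld.2 ⟨?_, fun i => i.elim0⟩)
      (Fin.succ_injective K) (fun j => ?_) (q := fun x => x.1 0) ?_ (fun x j h => ?_) fun w => ?_
    · rw [zero_add, norm_smul, hw, mul_one, Real.norm_of_nonneg (by positivity),
        div_mul_eq_mul_div, div_le_iff₀ (by positivity)]
      have : ((a : ℕ) : ℝ) ≤ K + 1 := by exact_mod_cast a.2.le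
      gcongr
    · rw [Fin.val_succ]
      positivity
    · exact continuous_subtype_val.comp ((continuous_apply 0).comp continuous_subtype_val)
    · exact Fin.succ_ne_zero j (x.2 (Subtype.ext h))
    · simp [sphereConf]
  · have hm' : max m 1 = m := by omega
    rw [hm', Nat.add_sub_cancel] at hupper
    refine hTC hupper ?_
    obtain ⟨δ, hδ, -, hin', hd⟩ := exists_margin hr0 hin hdisj
    let i₀ : Fin m := ⟨0, by omega⟩
    have hs : 0 < δ / k := by positivity
    have hρ : ∀ a : Fin k, 0 ≤ δ / k * (a : ℝ) ∧ δ / k * (a : ℝ) ≤ δ := by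
      intro a
      refine ⟨by positivity, ?_⟩
      rw [div_mul_eq_mul_div, div_le_iff₀ (by positivity)]
      have : ((a : ℕ) : ℝ) ≤ k := by exact_mod_cast a.2.le
      gcongr
    refine not_tcCover_conf he (by omega) (p := c i₀) (ρ := fun a => r i₀ + δ / k * a)
      (fun a => add_nonneg (hr i₀).le (hρ a).1) (fun a b hab => hsub hs (add_left_cancel hab))
      (fun a w hw => ?_) Function.injective_id (fun j => add_pos_of_pos_of_nonneg (hr i₀) (hρ j).1)
      (q := fun _ => c i₀) continuous_const (fun x j h => ?_) fun w => rfl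
    · have hnorm : ‖(r i₀ + δ / k * (a : ℝ)) • w‖ = r i₀ + δ / k * a := by
        rw [norm_smul, hw, mul_one, Real.norm_of_nonneg (add_nonneg (hr i₀).le (hρ a).1)]
      refine mem_sphereWorld.2 ⟨?_, fun i => ?_⟩
      · have := norm_add_le (c i₀) ((r i₀ + δ / k * (a : ℝ)) • w)
        linarith [hin' i₀, (hρ a).2]
      · by_cases hi : i = i₀
        · subst hi
          rw [add_sub_cancel_left, hnorm]
          linarith [(hρ a).1]
        · have h1 := hd i i₀ hi
          have h2 := norm_sub_le_norm_sub_add_norm_sub (c i) (c i₀ + (r i₀ + δ / k * (a : ℝ)) • w)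
            (c i₀)
          rw [add_sub_cancel_left, hnorm, norm_sub_rev (c i) (c i₀ + _)] at h2
          linarith [(hρ a).2]
    · have h1 := (mem_sphereWorld.1 (x.1 j).2).2 i₀
      rw [show ((x.1 j : _) : EuclideanSpace ℝ (Fin (e + 2))) = c i₀ from h, sub_self,
        norm_zero] at h1
      exact absurd h1 (not_le.2 (hr i₀))
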